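/- arXiv:2003.12802 — 3 statements merged into one kernel-verified Lean document; each statement's English description precedes it below -/
import Mathlib

section
/- There is no finite group G such that g^3 = 1 for every g ∈ G, Nat.card G = 3^8 = 6561, and Nat.card ⁅G,G⁆ = 3^5 = 243. Equivalently, no group of order 3^8 and exponent 3 has commutator subgroup of order 3^5. -/
namespace ExpThree

open scoped commutatorElement

lemma triple {G : Type*} [Group G] (hexp : ∀ g : G, g ^ 3 = 1) (g x : G) :
    x * (g * x * g⁻¹) * (g * (g * x * g⁻¹) * g⁻¹) = 1 := by
  have h1 := hexp (x * g)
  have h2 : g⁻¹ * g⁻¹ = g := by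
    have := hexp g
    rw [← mul_left_inj (g * g)]
    simp only [pow_succ, pow_zero, one_mul] at this
    rw [← mul_assoc g, this]; group
  calc _ = x * g * x * g * x * (g⁻¹ * g⁻¹) := by group
    _ = (x * g) ^ 3 := by rw [h2]; simp only [pow_succ, pow_zero, one_mul, mul_assoc]
    _ = 1 := h1

lemma inv_eq {G : Type*} [Group G] (hexp : ∀ g : G, g ^ 3 = 1) (g : G) : g⁻¹ = g * g := by
  have := hexp g
  rw [inv_eq_iff_mul_eq_one, ← this]
  simp only [pow_succ, pow_zero, one_mul, mul_assoc]

lemma comm_conj {G : Type*} [Group G] (hexp : ∀ g : G, g ^ 3 = 1) (g x : G) :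
    Commute x (g * x * g⁻¹) := by
  have h1 := triple hexp g (g⁻¹ * x * g)
  have h2 := triple hexp g⁻¹ (g * x * g⁻¹)
  have e : g * g = g⁻¹ := (inv_eq hexp g).symm
  have e3 : g * g * g = 1 := by rw [e]; simp
  have k1 : g⁻¹ * x * g = (x * (g * x * g⁻¹))⁻¹ := by
    rw [eq_inv_iff_mul_eq_one, ← h1]; group
  have k2 : g⁻¹ * x * g = ((g * x * g⁻¹) * x)⁻¹ := by
    rw [eq_inv_iff_mul_eq_one, mul_eq_one_iff_eq_inv, eq_comm, inv_eq_iff_mul_eq_one, ← h2]; group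
  exact inv_injective (k1.symm.trans k2)

lemma ring_aux {R : Type*} [Ring R] (A B : R) (hA : A * A = 0) (hB : B * B = 0)
    (hAB : (A + B + A * B) * (A + B + A * B) = 0) :
    A * B * A = 0 ∧ A * B = - (B * A) := by
  have e : A * B + B * A + A * B * A + B * A * B + A * B * A * B = 0 := by
    have : (A + B + A * B) * (A + B + A * B) = A * A + B * B + A * A * B + A * (B * B)
      + (A * B + B * A + A * B * A + B * A * B + A * B * A * B) := by noncomm_ring
    rw [this, hA, hB] at hAB
    simpa using hAB
  have e1 : A * B * A + A * B * A * B = 0 := by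
    have : A * (A * B + B * A + A * B * A + B * A * B + A * B * A * B) =
      A * A * B + A * B * A + A * A * (B * A) + A * B * A * B + A * A * (B * A * B) := by
      noncomm_ring
    rw [e, hA] at this
    simpa using this.symm
  have e2 : A * B * A = 0 := by
    have : (A * B * A + A * B * A * B) * B = A * B * A * B + A * B * A * (B * B) := by
      noncomm_ring
    rw [e1, hB] at this
    have h : A * B * A * B = 0 := by simpa using this.symm
    simpa [h] using e1
  have e3 : B * A * B = 0 := by
    have : B * (A * B + B * A + A * B * A + B * A * B + A * B * A * B) =
      B * A * B + B * B * A + B * (A * B * A) + B * B * A * B + B * (A * B * A) * B := by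
      noncomm_ring
    rw [e, hB, e2] at this
    simpa using this.symm
  refine ⟨e2, eq_neg_of_add_eq_zero_left ?_⟩
  simpa [e2, e3] using e

lemma module_aux {G N : Type*} [Group G] [CommGroup N] (φ : G →* MulAut N)
    (h3 : ∀ n : N, n ^ 3 = 1) (ht : ∀ g n, n * φ g n * φ g (φ g n) = 1) (a b : G) (c : N) :
    φ a (φ a c / c) = φ a c / c ∧
    (φ a (φ b (φ a c / c) / (φ a c / c)) = φ b (φ a c / c) / (φ a c / c)) ∧
    φ a (φ b c / c) / (φ b c / c) = (φ b (φ a c / c) / (φ a c / c))⁻¹ := by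
  let X : G → AddMonoid.End (Additive N) := fun g => MonoidHom.toAdditive (φ g).toMonoidHom
  have hX : ∀ g n, X g (Additive.ofMul n) = Additive.ofMul (φ g n) := fun g n => rfl
  have hm : ∀ g h, X (g * h) = X g * X h := by
    intro g h; ext n; simp [X]; rfl
  have hz : ∀ g, (X g - 1) * (X g - 1) = 0 := by
    intro g
    have e3 : (3 : AddMonoid.End (Additive N)) = 0 := by
      ext n
      have := h3 n.toMul
      have h' : (3 : ℕ) • n = 0 := this
      exact h'
    have e : 1 + X g + X g * X g = 0 := by
      ext n
      exact ht g n.toMul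
    calc _ = (1 + X g + X g * X g) - 3 * X g := by
            rw [show (3 : AddMonoid.End (Additive N)) = 1 + 1 + 1 by norm_num]
            simp only [sub_mul, mul_sub, add_mul, one_mul, mul_one]; abel
      _ = 0 := by rw [e, e3]; simp
  have hab := hz (a * b)
  have : X (a * b) - 1 = (X a - 1) + (X b - 1) + (X a - 1) * (X b - 1) := by
    rw [hm]; simp only [sub_mul, mul_sub, one_mul, mul_one]; abel
  rw [this] at hab
  obtain ⟨q1, q2⟩ := ring_aux _ _ (hz a) (hz b) hab
  refine ⟨?_, ?_, ?_⟩
  · have := DFunLike.congr_fun (hz a) (Additive.ofMul c)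
    have h' : φ a (φ a c / c) / (φ a c / c) = 1 := this
    exact div_eq_one.mp h'
  · have : (X a - 1) * ((X b - 1) * (X a - 1)) = 0 := by rw [← mul_assoc, q1]
    have := DFunLike.congr_fun this (Additive.ofMul c)
    have h' : φ a (φ b (φ a c / c) / (φ a c / c)) / (φ b (φ a c / c) / (φ a c / c)) = 1 := this
    exact div_eq_one.mp h'
  · exact DFunLike.congr_fun q2 (Additive.ofMul c)

lemma card_sup_le {N : Type*} [CommGroup N] [Finite N] (H : Subgroup N) (x : N) :
    Nat.card (H ⊔ Subgroup.zpowers x : Subgroup N) ≤ Nat.card H * orderOf x := by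
  rw [← Nat.card_zpowers]
  have := Set.natCard_mul_le (s := (H : Set N)) (t := (Subgroup.zpowers x : Set N))
  rw [← Subgroup.mul_normal] at this
  exact this

lemma inv_aux {G N : Type*} [Group G] [CommGroup N] (φ : G →* MulAut N)
    (hexp : ∀ g : G, g ^ 3 = 1)
    (h3 : ∀ n : N, n ^ 3 = 1) (ht : ∀ g n, n * φ g n * φ g (φ g n) = 1) (a b c' : G) (c : N)
    (hc : φ c' = 1) (hgen : Subgroup.closure {a, b, c'} = ⊤) (g : G) (k : N)
    (hk : k ∈ Subgroup.zpowers c ⊔ Subgroup.zpowers (φ a c / c) ⊔ Subgroup.zpowers (φ b c / c)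
      ⊔ Subgroup.zpowers (φ b (φ a c / c) / (φ a c / c))) :
    φ g k ∈ Subgroup.zpowers c ⊔ Subgroup.zpowers (φ a c / c) ⊔ Subgroup.zpowers (φ b c / c)
      ⊔ Subgroup.zpowers (φ b (φ a c / c) / (φ a c / c)) := by
  obtain ⟨p1, p2, p3⟩ := module_aux φ h3 ht a b c
  obtain ⟨r1, -, -⟩ := module_aux φ h3 ht b a c
  obtain ⟨s1, -, -⟩ := module_aux φ h3 ht b a (φ a c / c)
  set c1 := φ a c / c with hc1
  set c2 := φ b c / c with hc2
  set c3 := φ b c1 / c1 with hc3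
  set K := Subgroup.zpowers c ⊔ Subgroup.zpowers c1 ⊔ Subgroup.zpowers c2
      ⊔ Subgroup.zpowers c3 with hK
  have m0 : c ∈ K :=
    Subgroup.mem_sup_left (Subgroup.mem_sup_left (Subgroup.mem_sup_left (Subgroup.mem_zpowers c)))
  have m1 : c1 ∈ K :=
    Subgroup.mem_sup_left (Subgroup.mem_sup_left (Subgroup.mem_sup_right (Subgroup.mem_zpowers c1)))
  have m2 : c2 ∈ K := Subgroup.mem_sup_left (Subgroup.mem_sup_right (Subgroup.mem_zpowers c2))
  have m3 : c3 ∈ K := Subgroup.mem_sup_right (Subgroup.mem_zpowers c3)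
  have key : ∀ g, φ g c ∈ K → φ g c1 ∈ K → φ g c2 ∈ K → φ g c3 ∈ K → ∀ k ∈ K, φ g k ∈ K := by
    intro g h0 h1 h2 h3
    have : K ≤ K.comap (φ g).toMonoidHom := by
      conv_lhs => rw [hK]
      simp only [sup_le_iff, Subgroup.zpowers_le]
      exact ⟨⟨⟨h0, h1⟩, h2⟩, h3⟩
    exact fun k hk => this hk
  have hg : g ∈ Subgroup.closure {a, b, c'} := by rw [hgen]; trivial
  induction hg using Subgroup.closure_induction generalizing k with
  | mem x hx =>
    rcases hx with rfl | rfl | rfl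
    · refine key _ ?_ ?_ ?_ ?_ k hk
      · have : φ x c = c1 * c := by simp [hc1]
        rw [this]; exact mul_mem m1 m0
      · rw [p1]; exact m1
      · rw [div_eq_iff_eq_mul] at p3
        rw [p3]; exact mul_mem (inv_mem m3) m2
      · rw [p2]; exact m3
    · refine key _ ?_ ?_ ?_ ?_ k hk
      · have : φ x c = c2 * c := by simp [hc2]
        rw [this]; exact mul_mem m2 m0
      · have : φ x c1 = c3 * c1 := by simp [hc3]
        rw [this]; exact mul_mem m3 m1
      · rw [r1]; exact m2
      · rw [s1]; exact m3
    · rw [hc]; exact hk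
  | one => simpa using hk
  | mul x y _ _ hx hy => rw [map_mul]; exact hx _ (hy _ hk)
  | inv x _ hx => rw [inv_eq hexp, map_mul]; exact hx _ (hx _ hk)

lemma card_normalClosure {G : Type*} [Group G] [Finite G] (hexp : ∀ g : G, g ^ 3 = 1) (a b c : G)
    (hgen : Subgroup.closure {a, b, c} = ⊤) :
    Nat.card (Subgroup.normalClosure {c}) ≤
      orderOf c * orderOf ⁅a, c⁆ * orderOf ⁅b, c⁆ * orderOf ⁅b, ⁅a, c⁆⁆ := by
  have hcomm : ∀ x y : Subgroup.normalClosure {c}, x * y = y * x := by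
    have : IsMulCommutative (Subgroup.normalClosure {c}) := by
      apply Subgroup.isMulCommutative_closure
      intro x hx y hy
      simp only [Group.mem_conjugatesOfSet_iff, Set.mem_singleton_iff, exists_eq_left,
        isConj_iff] at hx hy
      obtain ⟨g, rfl⟩ := hx
      obtain ⟨h, rfl⟩ := hy
      have := comm_conj hexp (h * g⁻¹) (g * c * g⁻¹)
      convert this.eq using 2 <;> group
    exact fun x y => this.is_comm.comm x y
  letI : CommGroup (Subgroup.normalClosure {c}) :=
    { (inferInstance : Group (Subgroup.normalClosure {c})) with mul_comm := hcomm }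
  let c0 : Subgroup.normalClosure {c} := ⟨c, Subgroup.subset_normalClosure rfl⟩
  let φ : G →* MulAut (Subgroup.normalClosure {c}) := MulAut.conjNormal
  have hφ : ∀ g n, ((φ g n : Subgroup.normalClosure {c}) : G) = g * n * g⁻¹ := fun g n => rfl
  have hinv := inv_aux φ hexp (fun n => Subtype.ext (hexp n))
    (fun g n => Subtype.ext (triple hexp g n)) a b c c0
    (by
      ext n
      have : c * (n : G) = n * c := congrArg Subtype.val (hcomm c0 n)
      rw [hφ, this]; simp) hgen
  set c1 := φ a c0 / c0 with hc1
  set c2 := φ b c0 / c0 with hc2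
  set c3 := φ b c1 / c1 with hc3
  set K := Subgroup.zpowers c0 ⊔ Subgroup.zpowers c1 ⊔ Subgroup.zpowers c2
      ⊔ Subgroup.zpowers c3 with hK
  have e1 : (c1 : G) = ⁅a, c⁆ := div_eq_mul_inv (a * c * a⁻¹) c
  have e2 : (c2 : G) = ⁅b, c⁆ := div_eq_mul_inv (b * c * b⁻¹) c
  have e3 : (c3 : G) = ⁅b, ⁅a, c⁆⁆ := by
    rw [← e1]; exact div_eq_mul_inv (b * (c1 : G) * b⁻¹) c1
  have hn : (K.map (Subgroup.subtype _)).Normal := by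
    constructor
    rintro _ ⟨k, hk, rfl⟩ g
    exact ⟨φ g k, hinv g k hk, rfl⟩
  have hle : Subgroup.normalClosure {c} ≤ K.map (Subgroup.subtype _) := by
    apply Subgroup.normalClosure_le_normal
    rintro _ rfl
    exact ⟨c0, Subgroup.mem_sup_left (Subgroup.mem_sup_left (Subgroup.mem_sup_left
      (Subgroup.mem_zpowers c0))), rfl⟩
  have hcard : Nat.card (Subgroup.normalClosure {c}) ≤ Nat.card K := by
    refine (Nat.card_mono (Set.toFinite _) hle).trans ?_
    exact Nat.card_image_le (Set.toFinite _)
  refine hcard.trans ?_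
  have e0 : orderOf c = orderOf c0 := Subgroup.orderOf_coe c0
  rw [← e3, ← e2, ← e1, e0, Subgroup.orderOf_coe c1, Subgroup.orderOf_coe c2,
    Subgroup.orderOf_coe c3]
  refine (card_sup_le _ _).trans (Nat.mul_le_mul_right _ ?_)
  refine (card_sup_le _ _).trans (Nat.mul_le_mul_right _ ?_)
  refine (card_sup_le _ _).trans (Nat.mul_le_mul_right _ ?_)
  rw [Nat.card_zpowers]

lemma orderOf_le {G : Type*} [Group G] (hexp : ∀ g : G, g ^ 3 = 1) (g : G) : orderOf g ≤ 3 :=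
  Nat.le_of_dvd (by norm_num) (orderOf_dvd_of_pow_eq_one (hexp g))

lemma quot_exp {G : Type*} [Group G] (hexp : ∀ g : G, g ^ 3 = 1) (N : Subgroup G) [N.Normal]
    (q : G ⧸ N) : q ^ 3 = 1 := by
  obtain ⟨g, rfl⟩ := QuotientGroup.mk'_surjective N q
  rw [← map_pow, hexp, map_one]

lemma quot_gen {G : Type*} [Group G] (a b c : G)
    (hgen : Subgroup.closure {a, b, c} = ⊤) :
    Subgroup.closure {1, (a : G ⧸ Subgroup.normalClosure {c}), (b : G ⧸ _)} = ⊤ := by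
  have h := congrArg (Subgroup.map (QuotientGroup.mk' (Subgroup.normalClosure {c}))) hgen
  rw [MonoidHom.map_closure, ← MonoidHom.range_eq_map,
    MonoidHom.range_eq_top.mpr (QuotientGroup.mk'_surjective _)] at h
  rw [← top_le_iff, ← h]
  apply Subgroup.closure_mono
  have hc : (c : G ⧸ Subgroup.normalClosure {c}) = 1 :=
    (QuotientGroup.eq_one_iff c).mpr (Subgroup.subset_normalClosure rfl)
  rintro _ ⟨x, rfl | rfl | rfl, rfl⟩
  · simp
  · simp
  · left; exact hc

lemma card_le_one {G : Type*} [Group G] (h : Subgroup.closure {1, 1, (1 : G)} = ⊤) :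
    Nat.card G ≤ 1 := by
  have : (⊤ : Subgroup G) = ⊥ := by rw [← h]; simp
  rw [← Subgroup.card_top, this]; simp

lemma card_step {G : Type*} [Group G] (c : G) (m n : ℕ)
    (hm : Nat.card (Subgroup.normalClosure {c}) ≤ m)
    (hn : Nat.card (G ⧸ Subgroup.normalClosure {c}) ≤ n) : Nat.card G ≤ n * m := by
  rw [Subgroup.card_eq_card_quotient_mul_card_subgroup (Subgroup.normalClosure {c})]
  exact Nat.mul_le_mul hn hm

lemma card_one {G : Type*} [Group G] [Finite G] (hexp : ∀ g : G, g ^ 3 = 1) (c : G)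
    (hgen : Subgroup.closure {1, 1, c} = ⊤) : Nat.card G ≤ 3 := by
  refine card_step c 3 1 ?_ (card_le_one (quot_gen 1 1 c hgen))
  refine (card_normalClosure hexp _ _ _ hgen).trans ?_
  simpa using orderOf_le hexp c

lemma card_two {G : Type*} [Group G] [Finite G] (hexp : ∀ g : G, g ^ 3 = 1) (b c : G)
    (hgen : Subgroup.closure {1, b, c} = ⊤) : Nat.card G ≤ 27 := by
  refine card_step c 9 3 ?_ (card_one (quot_exp hexp _) _ (quot_gen 1 b c hgen))
  refine (card_normalClosure hexp _ _ _ hgen).trans ?_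
  simpa using Nat.mul_le_mul (orderOf_le hexp c) (orderOf_le hexp ⁅b, c⁆)

lemma card_three {G : Type*} [Group G] [Finite G] (hexp : ∀ g : G, g ^ 3 = 1) (a b c : G)
    (hgen : Subgroup.closure {a, b, c} = ⊤) : Nat.card G ≤ 3 ^ 7 := by
  refine card_step c 81 27 ?_ (card_two (quot_exp hexp _) _ _ (quot_gen a b c hgen))
  refine (card_normalClosure hexp _ _ _ hgen).trans ?_
  exact Nat.mul_le_mul (Nat.mul_le_mul (Nat.mul_le_mul (orderOf_le hexp _) (orderOf_le hexp _))
    (orderOf_le hexp _)) (orderOf_le hexp _)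

lemma frattini_aux {G : Type*} [Group G] [Finite G] [Group.IsNilpotent G] (K : Subgroup G)
    (h : K ⊔ commutator G = ⊤) : K = ⊤ := by
  by_contra hK
  obtain ⟨M, hM, hKM⟩ := (eq_top_or_exists_le_coatom K).resolve_left hK
  have hn : M.Normal :=
    Subgroup.NormalizerCondition.normal_of_coatom M Group.normalizerCondition_of_isNilpotent hM
  have hMtop : M ⊔ commutator G = ⊤ := top_le_iff.mp (h ▸ sup_le_sup_right hKM _)
  have : Nontrivial (G ⧸ M) := QuotientGroup.nontrivial_iff.mpr hM.1
  have hlt := Group.IsSolvable.commutator_lt_top_of_nontrivial (G ⧸ M)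
  apply hlt.ne
  have h2 := congrArg (Subgroup.map (QuotientGroup.mk' M)) hMtop
  rw [Subgroup.map_sup, QuotientGroup.map_mk'_self, bot_sup_eq, ← MonoidHom.range_eq_map,
    MonoidHom.range_eq_top.mpr (QuotientGroup.mk'_surjective _)] at h2
  rw [← top_le_iff, ← h2, commutator_def, commutator_def, Subgroup.map_commutator]
  exact Subgroup.commutator_mono le_top le_top

lemma index_step {G : Type*} [Group G] (H : Subgroup G) (k : ℕ) (h : H.index ∣ 3 ^ (k + 1)) :
    ∃ x, (H ⊔ Subgroup.zpowers x).index ∣ 3 ^ k := by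
  obtain ⟨j, hj, hH⟩ := (Nat.dvd_prime_pow Nat.prime_three).mp h
  by_cases htop : H = ⊤
  · subst htop; exact ⟨1, by simp⟩
  obtain ⟨x, -, hx⟩ := SetLike.exists_of_lt (lt_top_iff_ne_top.mpr htop)
  refine ⟨x, ?_⟩
  have hd := Subgroup.index_dvd_of_le (le_sup_left : H ≤ H ⊔ Subgroup.zpowers x)
  rw [hH] at hd
  obtain ⟨i, hi, hi'⟩ := (Nat.dvd_prime_pow Nat.prime_three).mp hd
  rw [hi']
  apply pow_dvd_pow
  by_contra hlt
  have hij : i = j := by omega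
  have hrel := Subgroup.relIndex_mul_index (le_sup_left : H ≤ H ⊔ Subgroup.zpowers x)
  rw [hi', hH, hij] at hrel
  have h1 : H.relIndex (H ⊔ Subgroup.zpowers x) = 1 := by
    have : 0 < 3 ^ j := by positivity
    nlinarith
  rw [Subgroup.relIndex_eq_one] at h1
  exact hx (h1 (Subgroup.mem_sup_right (Subgroup.mem_zpowers x)))

end ExpThree

/-- There is no finite group of order `3 ^ 8` and exponent 3 whose commutator subgroup has
order `3 ^ 5`. -/
theorem no_exponent_three_group_order_3_pow_8_commutator_3_pow_5
    (G : Type*) [Group G] [Finite G]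
    (hexp : ∀ g : G, g ^ 3 = 1)
    (hcard : Nat.card G = 3 ^ 8) :
    Nat.card ↥(commutator G) ≠ 3 ^ 5 := by
  intro hc
  have hp : IsPGroup 3 G := fun g => ⟨1, by simpa using hexp g⟩
  haveI : Fact (Nat.Prime 3) := ⟨Nat.prime_three⟩
  haveI : Group.IsNilpotent G := hp.isNilpotent
  have hi : (commutator G).index = 3 ^ 3 := by
    have := (commutator G).card_mul_index
    rw [hc, hcard] at this
    omega
  obtain ⟨a, ha⟩ := ExpThree.index_step (commutator G) 2 (by rw [hi])
  obtain ⟨b, hb⟩ := ExpThree.index_step _ 1 ha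
  obtain ⟨c, hc'⟩ := ExpThree.index_step _ 0 hb
  have htop := Subgroup.index_eq_one.mp (Nat.dvd_one.mp hc')
  have hgen : Subgroup.closure {a, b, c} = ⊤ := by
    apply ExpThree.frattini_aux
    rw [← top_le_iff, ← htop]
    refine sup_le (sup_le (sup_le le_sup_right ?_) ?_) ?_ <;>
    · rw [Subgroup.zpowers_le]
      exact Subgroup.mem_sup_left (Subgroup.subset_closure (by simp))
  have := ExpThree.card_three hexp a b c hgen
  rw [hcard] at this
  norm_num at this
end

section
/- Let p be an odd prime and m, n ≥ 1. There is a bijection between: (i) the set of isomorphism classes of finite groups G with Nat.card G = p^(m+n), g^p = 1 for all g ∈ G, commutator subgroup ⁅G,G⁆ contained in the center of G, and Nat.card ⁅G,G⁆ = p^n; and (ii) the set of orbits of the congruence action of GL_m(ZMod p) on the set of n-dimensional ZMod p-subspaces of AS_m(ZMod p). -/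
open Matrix

/-- A finite group `G` of order `p ^ (m + n)`, of exponent `p`, of nilpotency class at most 2
(i.e. `⁅G,G⁆ ≤ Z(G)`), and with commutator subgroup of order `p ^ n`. -/
structure ClassTwoGroupOfExpP (p m n : ℕ) where
  G : Type
  [grp : Group G]
  finite : Finite G
  card_eq : Nat.card G = p ^ (m + n)
  exp_p : ∀ g : G, g ^ p = 1
  comm_le_center : commutator G ≤ Subgroup.center G
  card_comm : Nat.card ↥(commutator G) = p ^ n

attribute [instance] ClassTwoGroupOfExpP.grp

/-- Isomorphism relation on such groups. -/
def isoRel (p m n : ℕ) (s t : ClassTwoGroupOfExpP p m n) : Prop :=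
  Nonempty (s.G ≃* t.G)

/-- The `n`-dimensional `ZMod p`-subspaces of the space of antisymmetric `m × m` matrices
over `ZMod p`. -/
def ASGrassmannian (p m n : ℕ) : Type :=
  {V : Submodule (ZMod p) (Matrix (Fin m) (Fin m) (ZMod p)) //
    (∀ X ∈ V, Xᵀ = -X) ∧ Module.finrank (ZMod p) V = n}

/-- Congruence relation: `V ∼ W` iff `W = P • V = {P * X * Pᵀ : X ∈ V}` for some
`P ∈ GL m (ZMod p)`. -/
def congRel (p m n : ℕ) (V W : ASGrassmannian p m n) : Prop :=
  ∃ P : GL (Fin m) (ZMod p),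
    (W.1 : Set (Matrix (Fin m) (Fin m) (ZMod p))) =
      (fun X => (P : Matrix (Fin m) (Fin m) (ZMod p)) * X *
        (P : Matrix (Fin m) (Fin m) (ZMod p))ᵀ) '' (V.1 : Set (Matrix (Fin m) (Fin m) (ZMod p)))


namespace BaerAux
open scoped commutatorElement

/-- The group on `E × Z` attached to a bilinear map `B`. -/
@[ext] structure BG {p : ℕ} {E Z : Type} [AddCommGroup E] [AddCommGroup Z]
    [Module (ZMod p) E] [Module (ZMod p) Z] (B : E →ₗ[ZMod p] E →ₗ[ZMod p] Z) where
  fst : E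
  snd : Z

section
variable {p : ℕ} {E Z : Type} [AddCommGroup E] [AddCommGroup Z]
    [Module (ZMod p) E] [Module (ZMod p) Z] (B : E →ₗ[ZMod p] E →ₗ[ZMod p] Z)

instance : Mul (BG B) := ⟨fun g h => ⟨g.fst + h.fst, g.snd + h.snd + (2 : ZMod p)⁻¹ • B g.fst h.fst⟩⟩
instance : One (BG B) := ⟨⟨0, 0⟩⟩
instance : Inv (BG B) := ⟨fun g => ⟨-g.fst, (2 : ZMod p)⁻¹ • B g.fst g.fst - g.snd⟩⟩

@[simp] lemma mul_fst (g h : BG B) : (g * h).fst = g.fst + h.fst := rfl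
@[simp] lemma mul_snd (g h : BG B) :
    (g * h).snd = g.snd + h.snd + (2 : ZMod p)⁻¹ • B g.fst h.fst := rfl
@[simp] lemma one_fst : (1 : BG B).fst = 0 := rfl
@[simp] lemma one_snd : (1 : BG B).snd = 0 := rfl
@[simp] lemma inv_fst (g : BG B) : (g⁻¹).fst = -g.fst := rfl
@[simp] lemma inv_snd (g : BG B) :
    (g⁻¹).snd = (2 : ZMod p)⁻¹ • B g.fst g.fst - g.snd := rfl

instance : Group (BG B) := Group.ofLeftAxioms
  (by intro a b c
      ext
      · simp [add_assoc]
      · simp [smul_add]; abel)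
  (by intro a; ext <;> simp)
  (by intro a; ext <;> simp)

/-- The underlying set. -/
def equivProd : BG B ≃ E × Z where
  toFun g := (g.fst, g.snd)
  invFun x := ⟨x.1, x.2⟩
  left_inv _ := rfl
  right_inv _ := rfl

/-- The projection to `E`. -/
def fstHom : BG B →* Multiplicative E where
  toFun g := Multiplicative.ofAdd g.fst
  map_one' := rfl
  map_mul' _ _ := rfl

lemma fst_of_comm (g : BG B) (hg : g ∈ commutator (BG B)) : g.fst = 0 := by
  have := Abelianization.commutator_subset_ker (fstHom B) hg
  exact this

lemma pow_eq (hB : ∀ x, B x x = 0) (g : BG B) (k : ℕ) : g ^ k = ⟨k • g.fst, k • g.snd⟩ := by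
  induction k with
  | zero => ext <;> simp
  | succ k ih =>
    rw [pow_succ, ih]
    ext
    · simp [add_smul]
    · simp [add_smul, hB]

lemma exp_p (hB : ∀ x, B x x = 0) (g : BG B) : g ^ p = 1 := by
  rw [pow_eq B hB]
  ext
  · simp [← Nat.cast_smul_eq_nsmul (ZMod p)]
  · simp [← Nat.cast_smul_eq_nsmul (ZMod p)]

lemma skew (hB : ∀ x, B x x = 0) (x y : E) : B y x = - B x y := by
  have := hB (x + y)
  simp only [map_add, LinearMap.add_apply, hB, zero_add, add_zero] at this
  exact eq_neg_of_add_eq_zero_left this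

lemma comm_eq [Fact p.Prime] (h2 : (2 : ZMod p) ≠ 0) (hB : ∀ x, B x x = 0) (g h : BG B) :
    ⁅g, h⁆ = ⟨0, B g.fst h.fst⟩ := by
  have e : (2 : ZMod p)⁻¹ + (2 : ZMod p)⁻¹ = 1 := by field_simp; norm_num
  have : g * h = ⟨0, B g.fst h.fst⟩ * (h * g) := by
    ext
    · simp [add_comm]
    · simp only [mul_snd, map_zero, LinearMap.zero_apply, smul_zero, add_zero, skew B hB g.fst h.fst]
      have : B g.fst h.fst = (2 : ZMod p)⁻¹ • B g.fst h.fst + (2 : ZMod p)⁻¹ • B g.fst h.fst := by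
        rw [← add_smul, e, one_smul]
      rw [smul_neg]
      nth_rw 2 [this]
      abel
  rw [commutatorElement_def, this]; group

/-- The span of the values of `B`. -/
def spanB : Submodule (ZMod p) Z := Submodule.span (ZMod p) {z | ∃ x y, B x y = z}

lemma mem_comm_iff [Fact p.Prime] (h2 : (2 : ZMod p) ≠ 0) (hB : ∀ x, B x x = 0) (g : BG B) :
    g ∈ commutator (BG B) ↔ g.fst = 0 ∧ g.snd ∈ spanB B := by
  constructor
  · intro hg
    let N : Subgroup (BG B) :=
      { carrier := {g | g.fst = 0 ∧ g.snd ∈ spanB B}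
        mul_mem' := by
          rintro a b ⟨h1, h2⟩ ⟨h3, h4⟩
          exact ⟨by simp [h1, h3], by simpa [h1, h3] using add_mem h2 h4⟩
        one_mem' := ⟨rfl, by simp⟩
        inv_mem' := by
          rintro a ⟨h1, h2⟩
          exact ⟨by simp [h1], by simpa [h1] using h2⟩ }
    have : commutator (BG B) ≤ N := by
      rw [commutator_def, Subgroup.commutator_le]
      intro a _ b _
      rw [comm_eq B h2 hB]
      exact ⟨rfl, Submodule.subset_span ⟨_, _, rfl⟩⟩
    exact this hg
  · rintro ⟨h1, hs⟩
    obtain ⟨x, z⟩ := g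
    simp only at h1 hs
    subst h1
    induction hs using Submodule.span_induction with
    | mem z hz =>
      obtain ⟨x, y, rfl⟩ := hz
      have := comm_eq B h2 hB ⟨x, 0⟩ ⟨y, 0⟩
      rw [← this]
      exact Subgroup.commutator_mem_commutator (Subgroup.mem_top _) (Subgroup.mem_top _)
    | zero => exact one_mem _
    | add a b _ _ ha hb =>
      have := mul_mem ha hb
      convert this using 1
      ext <;> simp
    | smul c a _ ha =>
      have := pow_mem ha c.val
      rw [pow_eq B hB] at this
      convert this using 1
      ext
      · simp
      · simp [← Nat.cast_smul_eq_nsmul (ZMod p)]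

lemma comm_central [Fact p.Prime] (h2 : (2 : ZMod p) ≠ 0) (hB : ∀ x, B x x = 0) :
    commutator (BG B) ≤ Subgroup.center (BG B) := by
  intro g hg
  rw [mem_comm_iff B h2 hB] at hg
  rw [Subgroup.mem_center_iff]
  intro h
  ext
  · simp [hg.1]
  · simp [hg.1, add_comm]

lemma card_comm [Fact p.Prime] (h2 : (2 : ZMod p) ≠ 0) (hB : ∀ x, B x x = 0) :
    Nat.card (commutator (BG B)) = Nat.card (spanB B) := by
  refine Nat.card_congr
    { toFun := fun g => ⟨g.1.snd, ((mem_comm_iff B h2 hB g.1).1 g.2).2⟩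
      invFun := fun z => ⟨⟨0, z.1⟩, (mem_comm_iff B h2 hB _).2 ⟨rfl, z.2⟩⟩
      left_inv := ?_
      right_inv := fun z => rfl }
  intro g
  have := ((mem_comm_iff B h2 hB g.1).1 g.2).1
  ext
  · exact this.symm
  · rfl

/-- Isomorphisms of bilinear maps give isomorphisms of groups. -/
def congrBG {E' Z' : Type} [AddCommGroup E'] [AddCommGroup Z']
    [Module (ZMod p) E'] [Module (ZMod p) Z'] (B' : E' →ₗ[ZMod p] E' →ₗ[ZMod p] Z')
    (e : E ≃ₗ[ZMod p] E') (f : Z ≃ₗ[ZMod p] Z') (h : ∀ x y, f (B x y) = B' (e x) (e y)) :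
    BG B ≃* BG B' where
  toFun g := ⟨e g.fst, f g.snd⟩
  invFun g := ⟨e.symm g.fst, f.symm g.snd⟩
  left_inv g := by ext <;> simp
  right_inv g := by ext <;> simp
  map_mul' a b := by ext <;> simp [h]

end

section
variable {p m : ℕ}

/-- The form attached to a space of matrices. -/
def formV (V : Submodule (ZMod p) (Matrix (Fin m) (Fin m) (ZMod p))) :
    (Fin m → ZMod p) →ₗ[ZMod p] (Fin m → ZMod p) →ₗ[ZMod p] Module.Dual (ZMod p) V :=
  LinearMap.mk₂ (ZMod p)
    (fun x y =>
      { toFun := fun X => x ⬝ᵥ (X.1 *ᵥ y)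
        map_add' := by intro a b; simp [Matrix.add_mulVec]
        map_smul' := by intro a b; simp [Matrix.smul_mulVec] })
    (by intros; ext; simp) (by intros; ext; simp)
    (by intros; ext; simp [Matrix.mulVec_add]) (by intros; ext; simp [Matrix.mulVec_smul])

@[simp] lemma formV_apply (V : Submodule (ZMod p) (Matrix (Fin m) (Fin m) (ZMod p)))
    (x y) (X : V) : formV V x y X = x ⬝ᵥ (X.1 *ᵥ y) := rfl

lemma formV_self [Fact p.Prime] (h2 : (2 : ZMod p) ≠ 0)
    (V : Submodule (ZMod p) (Matrix (Fin m) (Fin m) (ZMod p)))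
    (hV : ∀ X ∈ V, Xᵀ = -X) (x) : formV V x x = 0 := by
  ext X
  have h := hV X.1 X.2
  have : x ⬝ᵥ (X.1 *ᵥ x) = - (x ⬝ᵥ (X.1 *ᵥ x)) := by
    calc x ⬝ᵥ (X.1 *ᵥ x) = x ⬝ᵥ (X.1ᵀ *ᵥ x) := by
          rw [Matrix.mulVec_transpose, dotProduct_comm x (x ᵥ* X.1), Matrix.dotProduct_mulVec]
      _ = _ := by rw [h]; simp [Matrix.neg_mulVec]
  have h3 : 2 * (x ⬝ᵥ (X.1 *ᵥ x)) = 0 := by linear_combination this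
  simpa [h2] using h3

lemma matrix_ext_form (X Y : Matrix (Fin m) (Fin m) (ZMod p))
    (h : ∀ x y, x ⬝ᵥ (X *ᵥ y) = x ⬝ᵥ (Y *ᵥ y)) : X = Y := by
  ext i j
  simpa using h (Pi.single i 1) (Pi.single j 1)

lemma spanB_formV [Fact p.Prime]
    (V : Submodule (ZMod p) (Matrix (Fin m) (Fin m) (ZMod p))) : spanB (formV V) = ⊤ := by
  by_contra hne
  obtain ⟨f, hf, hle⟩ := Submodule.exists_le_ker_of_lt_top _ (lt_top_iff_ne_top.2 hne)
  obtain ⟨X, rfl⟩ := (Module.evalEquiv (ZMod p) V).surjective f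
  apply hf
  have : X.1 = 0 := by
    apply matrix_ext_form
    intro x y
    have : formV V x y ∈ spanB (formV V) := Submodule.subset_span ⟨_, _, rfl⟩
    simpa using hle this
  have : X = 0 := Subtype.ext this
  rw [this, map_zero]

end

section
variable {p m n : ℕ}

lemma two_ne (hp : p.Prime) (hodd : Odd p) : (2 : ZMod p) ≠ 0 := by
  intro h
  have : p ∣ 2 := (ZMod.natCast_eq_zero_iff 2 p).1 (by exact_mod_cast h)
  have := (Nat.prime_dvd_prime_iff_eq hp Nat.prime_two).1 this
  subst this
  exact absurd hodd (by decide)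

/-- The group attached to a space of antisymmetric matrices. -/
def toGroup (hp : p.Prime) (hodd : Odd p) (V : ASGrassmannian p m n) :
    ClassTwoGroupOfExpP p m n :=
  have := Fact.mk hp
  have h2 := two_ne hp hodd
  have hB := formV_self h2 V.1 V.2.1
  have hZ : Nat.card (Module.Dual (ZMod p) V.1) = p ^ n := by
    rw [Module.natCard_eq_pow_finrank (K := ZMod p), Subspace.dual_finrank_eq, V.2.2, Nat.card_zmod]
  have hE : Nat.card (BG (formV V.1)) = p ^ (m + n) := by
    rw [Nat.card_congr (equivProd _), Nat.card_prod, hZ, pow_add]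
    simp
  { G := BG (formV V.1)
    finite := Nat.finite_of_card_ne_zero (by rw [hE]; exact pow_ne_zero _ hp.ne_zero)
    card_eq := hE
    exp_p := exp_p _ hB
    comm_le_center := comm_central _ h2 hB
    card_comm := by
      rw [card_comm _ h2 hB, spanB_formV, ← hZ]
      exact Nat.card_congr Submodule.topEquiv.toEquiv }

lemma iso_of_cong (hp : p.Prime) (hodd : Odd p) (V W : ASGrassmannian p m n)
    (h : congRel p m n V W) : isoRel p m n (toGroup hp hodd V) (toGroup hp hodd W) := by
  have := Fact.mk hp
  obtain ⟨P, hP⟩ := h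
  let T0 : Matrix (Fin m) (Fin m) (ZMod p) →ₗ[ZMod p] Matrix (Fin m) (Fin m) (ZMod p) :=
    { toFun := fun X => P.1 * X * P.1ᵀ
      map_add' := by intros; simp [mul_add, add_mul]
      map_smul' := by intros; simp }
  have hT : ∀ X ∈ V.1, T0 X ∈ W.1 := by
    intro X hX
    have : T0 X ∈ (W.1 : Set _) := by rw [hP]; exact ⟨X, hX, rfl⟩
    exact this
  have hPu : IsUnit P.1 := P.isUnit
  have hPt : IsUnit P.1ᵀ := (Matrix.isUnit_transpose _).2 hPu
  let T : V.1 ≃ₗ[ZMod p] W.1 := LinearEquiv.ofBijective (T0.restrict hT) (by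
    constructor
    · intro X Y hXY
      have h1 : P.1 * X.1 * P.1ᵀ = P.1 * Y.1 * P.1ᵀ := congrArg Subtype.val hXY
      exact Subtype.ext (hPu.mul_left_cancel (hPt.mul_right_cancel h1))
    · intro Y
      have : Y.1 ∈ (W.1 : Set _) := Y.2
      rw [hP] at this
      obtain ⟨X, hX, hXY⟩ := this
      exact ⟨⟨X, hX⟩, Subtype.ext hXY⟩)
  let e : (Fin m → ZMod p) ≃ₗ[ZMod p] (Fin m → ZMod p) :=
    LinearEquiv.ofBijective (Matrix.mulVecLin P.1ᵀ)
      ⟨Matrix.mulVec_injective_iff_isUnit.2 hPt, Matrix.mulVec_surjective_iff_isUnit.2 hPt⟩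
  refine ⟨(congrBG (formV W.1) (formV V.1) e T.dualMap ?_).symm⟩
  intro x y
  ext X
  change x ⬝ᵥ ((P.1 * X.1 * P.1ᵀ) *ᵥ y) = (P.1ᵀ *ᵥ x) ⬝ᵥ (X.1 *ᵥ (P.1ᵀ *ᵥ y))
  rw [Matrix.mulVec_transpose P.1 x, ← Matrix.dotProduct_mulVec]
  simp [Matrix.mulVec_mulVec, Matrix.mul_assoc]

lemma cong_of_iso (hp : p.Prime) (hodd : Odd p) (V W : ASGrassmannian p m n)
    (h : isoRel p m n (toGroup hp hodd V) (toGroup hp hodd W)) : congRel p m n W V := by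
  have := Fact.mk hp
  have h2 := two_ne hp hodd
  have hBV := formV_self h2 V.1 V.2.1
  have hBW := formV_self h2 W.1 W.2.1
  obtain ⟨φ⟩ := h
  change BG (formV V.1) ≃* BG (formV W.1) at φ
  have key : ∀ a, (φ ⟨0, a⟩).fst = 0 := by
    intro a
    have h1 : (⟨0, a⟩ : BG (formV V.1)) ∈ commutator (BG (formV V.1)) := by
      rw [mem_comm_iff _ h2 hBV]
      exact ⟨rfl, by rw [spanB_formV]; trivial⟩
    have := Abelianization.commutator_subset_ker ((fstHom (formV W.1)).comp φ.toMonoidHom) h1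
    exact this
  have dec : ∀ x a, (⟨x, a⟩ : BG (formV V.1)) = ⟨x, 0⟩ * ⟨0, a⟩ := by
    intro x a; ext <;> simp
  have key2 : ∀ x a, (φ ⟨x, a⟩).fst = (φ ⟨x, 0⟩).fst := by
    intro x a
    rw [dec x a, map_mul, mul_fst, key, add_zero]
  let P0 : (Fin m → ZMod p) →+ (Fin m → ZMod p) :=
    { toFun := fun x => (φ ⟨x, 0⟩).fst
      map_zero' := key 0
      map_add' := by
        intro x y
        rw [← mul_fst, ← map_mul]
        exact (key2 (x + y) _).symm }
  let P := P0.toZModLinearMap p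
  have hP : ∀ x, P x = (φ ⟨x, 0⟩).fst := fun x => rfl
  have hPs : Function.Surjective P := by
    intro y
    refine ⟨(φ.symm ⟨y, 0⟩).fst, ?_⟩
    rw [hP, ← key2 _ (φ.symm ⟨y, 0⟩).snd]
    change (φ (φ.symm ⟨y, 0⟩)).fst = y
    simp
  let ψ0 : Module.Dual (ZMod p) V.1 →+ Module.Dual (ZMod p) W.1 :=
    { toFun := fun a => (φ ⟨0, a⟩).snd
      map_zero' := by
        have : φ ⟨0, 0⟩ = 1 := map_one φ
        rw [this]; rfl
      map_add' := by
        intro a b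
        have : (⟨0, a + b⟩ : BG (formV V.1)) = ⟨0, a⟩ * ⟨0, b⟩ := by ext <;> simp
        rw [this, map_mul, mul_snd, key, key]; simp }
  let ψ := ψ0.toZModLinearMap p
  have hψ : ∀ x y, ψ (formV V.1 x y) = formV W.1 (P x) (P y) := by
    intro x y
    have h1 := comm_eq (formV V.1) h2 hBV ⟨x, 0⟩ ⟨y, 0⟩
    have h3 := congrArg φ h1
    rw [map_commutatorElement, comm_eq _ h2 hBW] at h3
    exact (congrArg BG.snd h3).symm
  let Q := LinearMap.toMatrix' P
  have hQ : ∀ x, Q *ᵥ x = P x := fun x => LinearMap.toMatrix'_mulVec P x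
  have hQu : IsUnit Q := by
    rw [← Matrix.mulVec_surjective_iff_isUnit]
    intro y
    obtain ⟨x, hx⟩ := hPs y
    exact ⟨x, by rw [← hx, hQ]⟩
  have hQt : IsUnit Qᵀ := (Matrix.isUnit_transpose _).2 hQu
  have hmem : ∀ X ∈ W.1, Qᵀ * X * Q ∈ V.1 := by
    intro X hX
    obtain ⟨Y, hY⟩ := (Module.evalEquiv (ZMod p) V.1).surjective
      ((Module.Dual.eval (ZMod p) W.1 ⟨X, hX⟩).comp ψ)
    have : Qᵀ * X * Q = Y.1 := by
      apply matrix_ext_form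
      intro x y
      have h1 := congrArg (fun f => f (formV V.1 x y)) hY
      simp only [Module.evalEquiv_apply, Module.Dual.eval_apply, formV_apply, LinearMap.comp_apply, hψ] at h1
      rw [h1, ← hQ, ← hQ, ← Matrix.mulVec_mulVec, ← Matrix.mulVec_mulVec, Matrix.dotProduct_mulVec x,
        Matrix.vecMul_transpose]
    rw [this]; exact Y.2
  let T0 : Matrix (Fin m) (Fin m) (ZMod p) →ₗ[ZMod p] Matrix (Fin m) (Fin m) (ZMod p) :=
    { toFun := fun X => Qᵀ * X * Q
      map_add' := by intros; simp [mul_add, add_mul]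
      map_smul' := by intros; simp }
  have hTi : Function.Injective T0 := by
    intro X Y h1
    exact hQt.mul_left_cancel (hQu.mul_right_cancel h1)
  have hle : W.1.map T0 ≤ V.1 := by
    rintro _ ⟨X, hX, rfl⟩
    exact hmem X hX
  have heq : W.1.map T0 = V.1 := by
    apply Submodule.eq_of_le_of_finrank_eq hle
    rw [(Submodule.equivMapOfInjective T0 hTi W.1).symm.finrank_eq, W.2.2, V.2.2]
  refine ⟨hQt.unit, ?_⟩
  rw [← heq]
  ext X
  simp [T0]

end

section
variable {p m n : ℕ}

lemma exists_space (hp : p.Prime) (hodd : Odd p) {E Z : Type} [AddCommGroup E] [AddCommGroup Z]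
    [Module (ZMod p) E] [Module (ZMod p) Z] (B : E →ₗ[ZMod p] E →ₗ[ZMod p] Z)
    (hB : ∀ x, B x x = 0) (hspan : spanB B = ⊤)
    (hE : Nat.card E = p ^ m) (hZ : Nat.card Z = p ^ n) :
    ∃ V : ASGrassmannian p m n, Nonempty (BG B ≃* BG (formV V.1)) := by
  have := Fact.mk hp
  have : Finite E := Nat.finite_of_card_ne_zero (by rw [hE]; exact pow_ne_zero _ hp.ne_zero)
  have : Finite Z := Nat.finite_of_card_ne_zero (by rw [hZ]; exact pow_ne_zero _ hp.ne_zero)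
  have fE : Module.finrank (ZMod p) E = m := by
    rw [Module.natCard_eq_pow_finrank (K := ZMod p), Nat.card_zmod] at hE
    exact Nat.pow_right_injective hp.two_le hE
  have fZ : Module.finrank (ZMod p) Z = n := by
    rw [Module.natCard_eq_pow_finrank (K := ZMod p), Nat.card_zmod] at hZ
    exact Nat.pow_right_injective hp.two_le hZ
  let b := Module.finBasisOfFinrankEq (ZMod p) E fE
  let M : Module.Dual (ZMod p) Z →ₗ[ZMod p] Matrix (Fin m) (Fin m) (ZMod p) :=
    { toFun := fun f => Matrix.of fun i j => f (B (b i) (b j))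
      map_add' := by intros; ext; simp
      map_smul' := by intros; ext; simp }
  have hM : ∀ f x y, (b.equivFun x) ⬝ᵥ (M f *ᵥ (b.equivFun y)) = f (B x y) := by
    intro f x y
    conv_rhs => rw [← b.sum_equivFun x, ← b.sum_equivFun y]
    simp only [map_sum, LinearMap.sum_apply, map_smul, LinearMap.smul_apply, smul_eq_mul,
      dotProduct, Matrix.mulVec, Finset.mul_sum, M, LinearMap.coe_mk, AddHom.coe_mk, Matrix.of_apply]
    first
    | (refine Finset.sum_congr rfl fun i _ => Finset.sum_congr rfl fun j _ => ?_; ring1)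
    | (rw [Finset.sum_comm]; refine Finset.sum_congr rfl fun i _ => Finset.sum_congr rfl fun j _ => ?_; ring1)
  have hMi : Function.Injective M := by
    rw [← LinearMap.ker_eq_bot, LinearMap.ker_eq_bot']
    intro f hf
    have h0 : spanB B ≤ LinearMap.ker f := by
      rw [spanB, Submodule.span_le]
      rintro _ ⟨x, y, rfl⟩
      have := hM f x y
      rw [hf] at this
      simpa using this.symm
    rw [hspan, top_le_iff, LinearMap.ker_eq_top] at h0
    exact h0
  let V : ASGrassmannian p m n := ⟨LinearMap.range M, by
    constructor
    · rintro _ ⟨f, rfl⟩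
      ext i j
      simp [M, skew B hB (b i) (b j)]
    · rw [LinearMap.finrank_range_of_inj hMi, Subspace.dual_finrank_eq, fZ]⟩
  let T : Module.Dual (ZMod p) Z ≃ₗ[ZMod p] V.1 := LinearEquiv.ofInjective M hMi
  refine ⟨V, ⟨congrBG B (formV V.1) b.equivFun
    ((Module.evalEquiv (ZMod p) Z).trans T.symm.dualMap) ?_⟩⟩
  intro x y
  ext X
  obtain ⟨f, rfl⟩ := T.surjective X
  have h1 : (T f).1 = M f := rfl
  simp only [formV_apply, h1, hM]
  simp

end

section
variable {G : Type} [Group G]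

lemma comm_mul_left (hc : commutator G ≤ Subgroup.center G) (x y z : G) :
    ⁅x * y, z⁆ = ⁅x, z⁆ * ⁅y, z⁆ := by
  have hz : ⁅y, z⁆ ∈ Subgroup.center G :=
    hc (Subgroup.commutator_mem_commutator (Subgroup.mem_top _) (Subgroup.mem_top _))
  have h1 : ⁅x * y, z⁆ = x * ⁅y, z⁆ * x⁻¹ * ⁅x, z⁆ := by
    simp only [commutatorElement_def]; group
  rw [h1, Subgroup.mem_center_iff.1 hz x, mul_inv_cancel_right, Subgroup.mem_center_iff.1 hz]

lemma comm_mul_right (hc : commutator G ≤ Subgroup.center G) (x y z : G) :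
    ⁅z, x * y⁆ = ⁅z, x⁆ * ⁅z, y⁆ := by
  rw [← commutatorElement_inv, comm_mul_left hc, _root_.mul_inv_rev, commutatorElement_inv,
    commutatorElement_inv]
  have hz : ⁅z, y⁆ ∈ Subgroup.center G :=
    hc (Subgroup.commutator_mem_commutator (Subgroup.mem_top _) (Subgroup.mem_top _))
  rw [Subgroup.mem_center_iff.1 hz]

/-- The Baer sum on `G`, for a given central bimultiplicative correction `k`. -/
@[reducible] def baerAdd (k : G → G → G) (hcen : ∀ x y z, k x y * z = z * k x y)
    (hl : ∀ x y z, k (x * y) z = k x z * k y z) (hr : ∀ x y z, k z (x * y) = k z x * k z y)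
    (hs : ∀ x, k x x = 1) (hsym : ∀ x y, x * y * k x y = y * x * k y x)
    (hz : ∀ x z, (∀ w, z * w = w * z) → k x z = 1 ∧ k z x = 1) : AddCommGroup G :=
  { add := fun x y => x * y * k x y
    zero := 1
    neg := fun x => x⁻¹
    add_assoc := by
      intro x y z
      change x * y * k x y * z * k (x * y * k x y) z = x * (y * z * k y z) * k x (y * z * k y z)
      rw [hl (x * y), hl, hr (y * z), hr, (hz x (k y z) (hcen y z)).1,
        (hz z (k x y) (hcen x y)).2]
      calc x * y * k x y * z * (k x z * k y z * 1)
          = x * y * (k x y * z) * (k x z * k y z) := by group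
        _ = x * y * z * k x y * (k x z * k y z) := by rw [hcen x y z]; group
        _ = x * y * z * (k x y * k x z * k y z) := by group
        _ = x * y * z * (k y z * (k x y * k x z)) := by rw [← hcen y z]
        _ = _ := by group
    zero_add := by
      intro x
      change 1 * x * k 1 x = x
      rw [(hz x 1 (by simp)).2]; simp
    add_zero := by
      intro x
      change x * 1 * k x 1 = x
      rw [(hz x 1 (by simp)).1]; simp
    neg_add_cancel := by
      intro x
      change x⁻¹ * x * k x⁻¹ x = 1
      have : k (x⁻¹ * x) x = 1 := by rw [inv_mul_cancel]; exact (hz x 1 (by simp)).2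
      rw [hl, hs, mul_one] at this
      rw [this]; simp
    add_comm := by
      intro x y
      exact hsym x y
    nsmul := @nsmulRec G ⟨1⟩ ⟨fun x y => x * y * k x y⟩
    zsmul := @zsmulRec G ⟨1⟩ ⟨fun x y => x * y * k x y⟩ ⟨fun x => x⁻¹⟩
      (@nsmulRec G ⟨1⟩ ⟨fun x y => x * y * k x y⟩) }

lemma exists_form_aux (p m n q : ℕ) [AddCommGroup G] [Module (ZMod p) G]
    (hadd : ∀ x y : G, x + y = x * y * ⁅y, x⁆ ^ (q + 1)) (hzero : (0 : G) = 1)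
    (hneg : ∀ x : G, -x = x⁻¹) (hq : p = 2 * q + 1) (hp : p.Prime) 
    (hcard : Nat.card G = p ^ (m + n)) (hexp : ∀ g : G, g ^ p = 1)
    (hc : commutator G ≤ Subgroup.center G) (hcc : Nat.card (commutator G) = p ^ n) :
    ∃ V : ASGrassmannian p m n, Nonempty (G ≃* BG (formV V.1)) := by
  have := Fact.mk hp
  have hodd : Odd p := ⟨q, hq⟩
  have h2 := two_ne hp hodd
  have hmem : ∀ x y : G, ⁅x, y⁆ ∈ commutator G := fun x y =>
    Subgroup.commutator_mem_commutator (Subgroup.mem_top _) (Subgroup.mem_top _)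
  have hcen0 : ∀ x y z : G, ⁅x, y⁆ * z = z * ⁅x, y⁆ := fun x y z =>
    (Subgroup.mem_center_iff.1 (hc (hmem x y)) z).symm
  have hz0 : ∀ x z : G, (∀ w, z * w = w * z) → ⁅x, z⁆ = 1 ∧ ⁅z, x⁆ = 1 := by
    intro x z hz
    exact ⟨commutatorElement_eq_one_iff_mul_comm.2 (hz x).symm,
      commutatorElement_eq_one_iff_mul_comm.2 (hz x)⟩
  have hsq : ∀ x y : G, ⁅x, y⁆ = ⁅x, y⁆ ^ (q + 1) * ⁅x, y⁆ ^ (q + 1) := by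
    intro x y
    rw [← pow_add, show q + 1 + (q + 1) = p + 1 by omega, pow_succ, hexp, one_mul]
  have hinv : ∀ x y : G, ⁅x, y⁆ ^ (q + 1) * ⁅y, x⁆ ^ (q + 1) = 1 := by
    intro x y
    rw [← commutatorElement_inv x y, inv_pow, mul_inv_cancel]
  have hkcen : ∀ x y z : G, ⁅y, x⁆ ^ (q + 1) * z = z * ⁅y, x⁆ ^ (q + 1) := fun x y z =>
    (Commute.pow_left (hcen0 y x z) (q + 1)).eq
  have haddc : ∀ x, ∀ z ∈ commutator G, x + z = x * z := by
    intro x z hz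
    rw [hadd, (hz0 x z (fun w => (Subgroup.mem_center_iff.1 (hc hz) w).symm)).2, one_pow, mul_one]
  have hnsmul : ∀ (k : ℕ) (x : G), k • x = x ^ k := by
    intro k x
    induction k with
    | zero => simp [hzero]
    | succ k ih =>
      rw [succ_nsmul, ih, hadd, commutatorElement_eq_one_iff_mul_comm.2 (pow_mul_comm' x k).symm,
        one_pow, mul_one, pow_succ]
  let Z0 : AddSubgroup G :=
    { carrier := commutator G
      add_mem' := by
        intro a b ha hb
        rw [haddc a b hb]; exact mul_mem ha hb
      zero_mem' := by rw [hzero]; exact one_mem _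
      neg_mem' := by intro a ha; rw [hneg]; exact inv_mem ha }
  let Z : Submodule (ZMod p) G := AddSubgroup.toZModSubmodule p Z0
  obtain ⟨E, hE⟩ := Submodule.exists_isCompl Z
  have hbl : ∀ x y z : G, ⁅x + y, z⁆ = ⁅x, z⁆ + ⁅y, z⁆ := by
    intro x y z
    rw [haddc _ _ (hmem _ _), hadd, comm_mul_left hc, comm_mul_left hc, (hz0 _ _ (hkcen _ _)).2,
      mul_one]
  have hbr : ∀ x y z : G, ⁅z, x + y⁆ = ⁅z, x⁆ + ⁅z, y⁆ := by
    intro x y z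
    rw [haddc _ _ (hmem _ _), hadd, comm_mul_right hc, comm_mul_right hc, (hz0 _ _ (hkcen _ _)).1,
      mul_one]
  let B0 : E → E →ₗ[ZMod p] Z := fun x => AddMonoidHom.toZModLinearMap p
    (AddMonoidHom.mk' (fun y : E => (⟨⁅x.1, y.1⁆, hmem _ _⟩ : Z))
      (fun a b => Subtype.ext (hbr a.1 b.1 x.1)))
  let B : E →ₗ[ZMod p] E →ₗ[ZMod p] Z := AddMonoidHom.toZModLinearMap p
    (AddMonoidHom.mk' B0 (fun a b => LinearMap.ext fun z => Subtype.ext (hbl a.1 b.1 z.1)))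
  have hBv : ∀ x y : E, (B x y).1 = ⁅x.1, y.1⁆ := fun x y => rfl
  have hB : ∀ x, B x x = 0 := by
    intro x
    apply Subtype.ext
    rw [hBv, commutatorElement_self, ← hzero]; rfl
  have hhalf : (2 : ZMod p)⁻¹ = ((q + 1 : ℕ) : ZMod p) := by
    have h3 : ((2 * (q + 1) : ℕ) : ZMod p) = 1 := by
      rw [show 2 * (q + 1) = p + 1 by omega]; simp
    push_cast at h3 ⊢
    field_simp
    exact h3.symm
  let φ : BG B →* G := MonoidHom.mk' (fun g => g.fst.1 * g.snd.1) (by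
    intro g h
    obtain ⟨x, a⟩ := g
    obtain ⟨y, b⟩ := h
    have ha : ∀ w, a.1 * w = w * a.1 := fun w => (Subgroup.mem_center_iff.1 (hc a.2) w).symm
    have e1 : (a + b + (2 : ZMod p)⁻¹ • B x y).1 = a.1 * b.1 * ⁅x.1, y.1⁆ ^ (q + 1) := by
      rw [hhalf, Nat.cast_smul_eq_nsmul]
      change (a.1 + b.1) + (((q + 1) • B x y : Z) : G) = _
      have : (((q + 1) • B x y : Z) : G) = ⁅x.1, y.1⁆ ^ (q + 1) := by
        rw [← hnsmul, ← hBv]; rfl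
      rw [this, haddc _ _ (pow_mem (hmem _ _) _), haddc _ _ b.2]
    change (x.1 + y.1) * (a + b + (2 : ZMod p)⁻¹ • B x y).1 = (x.1 * a.1) * (y.1 * b.1)
    rw [e1, hadd]
    calc x.1 * y.1 * ⁅y.1, x.1⁆ ^ (q + 1) * (a.1 * b.1 * ⁅x.1, y.1⁆ ^ (q + 1))
        = x.1 * y.1 * (⁅y.1, x.1⁆ ^ (q + 1) * (a.1 * b.1)) * ⁅x.1, y.1⁆ ^ (q + 1) := by
          simp only [mul_assoc]
      _ = x.1 * y.1 * (a.1 * b.1) * (⁅y.1, x.1⁆ ^ (q + 1) * ⁅x.1, y.1⁆ ^ (q + 1)) := by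
          rw [hkcen]; simp only [mul_assoc]
      _ = x.1 * (y.1 * a.1) * b.1 := by rw [hinv]; simp only [mul_assoc, mul_one]
      _ = _ := by rw [← ha]; simp only [mul_assoc])
  let L := Submodule.prodEquivOfIsCompl E Z hE.symm
  have hφ : ∀ g, φ g = L (equivProd B g) := by
    intro g
    change g.fst.1 * g.snd.1 = L (g.fst, g.snd)
    rw [Submodule.coe_prodEquivOfIsCompl', haddc _ _ g.snd.2]
  have hφb : Function.Bijective φ := by
    have : (φ : BG B → G) = L ∘ equivProd B := funext hφ
    rw [this]
    exact L.bijective.comp (equivProd B).bijective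
  let Φ : BG B ≃* G := MulEquiv.ofBijective φ hφb
  have cZ : Nat.card Z = p ^ n := hcc
  have cE : Nat.card E = p ^ m := by
    have h3 := Nat.card_congr L.toEquiv
    rw [Nat.card_prod, cZ, hcard, pow_add] at h3
    exact Nat.eq_of_mul_eq_mul_right (pow_pos hp.pos n) h3
  have : Finite Z := Nat.finite_of_card_ne_zero (by rw [cZ]; exact pow_ne_zero _ hp.ne_zero)
  have hspan : spanB B = ⊤ := by
    have h3 : Nat.card (spanB B) = Nat.card Z := by
      rw [← card_comm B h2 hB, cZ, ← hcc]
      have h4 : (commutator (BG B)).map φ = commutator G := by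
        rw [commutator_def, Subgroup.map_commutator, commutator_def,
          Subgroup.map_top_of_surjective _ hφb.2]
      rw [← h4]
      exact Nat.card_congr (Subgroup.equivMapOfInjective _ _ hφb.1).toEquiv
    have h5 : ((spanB B : Submodule (ZMod p) Z) : Set Z) = Set.univ := by
      apply Set.eq_of_subset_of_ncard_le (Set.subset_univ _)
      rw [Set.ncard_univ, ← h3]
      exact le_of_eq (Nat.card_coe_set_eq _)
    exact SetLike.coe_injective h5
  obtain ⟨V, ⟨ψ⟩⟩ := exists_space hp hodd B hB hspan cE cZ
  exact ⟨V, ⟨Φ.symm.trans ψ⟩⟩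

lemma exists_form (p m n : ℕ) (hp : p.Prime) (hodd : Odd p)
    (hcard : Nat.card G = p ^ (m + n)) (hexp : ∀ g : G, g ^ p = 1)
    (hc : commutator G ≤ Subgroup.center G) (hcc : Nat.card (commutator G) = p ^ n) :
    ∃ V : ASGrassmannian p m n, Nonempty (G ≃* BG (formV V.1)) := by
  have := Fact.mk hp
  have h2 := two_ne hp hodd
  obtain ⟨q, hq⟩ := hodd
  have hodd : Odd p := ⟨q, hq⟩
  have hmem : ∀ x y : G, ⁅x, y⁆ ∈ commutator G := fun x y =>
    Subgroup.commutator_mem_commutator (Subgroup.mem_top _) (Subgroup.mem_top _)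
  have hcen0 : ∀ x y z : G, ⁅x, y⁆ * z = z * ⁅x, y⁆ := fun x y z =>
    (Subgroup.mem_center_iff.1 (hc (hmem x y)) z).symm
  have hz0 : ∀ x z : G, (∀ w, z * w = w * z) → ⁅x, z⁆ = 1 ∧ ⁅z, x⁆ = 1 := by
    intro x z hz
    exact ⟨commutatorElement_eq_one_iff_mul_comm.2 (hz x).symm,
      commutatorElement_eq_one_iff_mul_comm.2 (hz x)⟩
  have hsq : ∀ x y : G, ⁅x, y⁆ = ⁅x, y⁆ ^ (q + 1) * ⁅x, y⁆ ^ (q + 1) := by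
    intro x y
    rw [← pow_add, show q + 1 + (q + 1) = p + 1 by omega, pow_succ, hexp, one_mul]
  have hinv : ∀ x y : G, ⁅x, y⁆ ^ (q + 1) * ⁅y, x⁆ ^ (q + 1) = 1 := by
    intro x y
    rw [← commutatorElement_inv x y, inv_pow, mul_inv_cancel]
  have hkcen : ∀ x y z : G, ⁅y, x⁆ ^ (q + 1) * z = z * ⁅y, x⁆ ^ (q + 1) := fun x y z =>
    (Commute.pow_left (hcen0 y x z) (q + 1)).eq
  let _ : AddCommGroup G := baerAdd (fun x y => ⁅y, x⁆ ^ (q + 1))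
    hkcen
    (by intro x y z; simp only [comm_mul_right hc]; exact Commute.mul_pow (hcen0 _ _ _) _)
    (by intro x y z; simp only [comm_mul_left hc]; exact Commute.mul_pow (hcen0 _ _ _) _)
    (by intro x; simp)
    (by
      intro x y
      have h1 : x * y = ⁅x, y⁆ * (y * x) := by simp only [commutatorElement_def]; group
      have h3 : x * y = y * x * ⁅x, y⁆ ^ (q + 1) * ⁅x, y⁆ ^ (q + 1) := by
        rw [mul_assoc, ← hsq, ← hcen0, ← h1]
      beta_reduce
      rw [h3, mul_assoc _ _ (⁅y, x⁆ ^ (q + 1)), hinv, mul_one])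
    (by
      intro x z hz
      simp only [(hz0 x z hz).1, (hz0 x z hz).2, one_pow, and_self])
  have hadd : ∀ x y : G, x + y = x * y * ⁅y, x⁆ ^ (q + 1) := fun x y => rfl
  have hzero : (0 : G) = 1 := rfl
  have hneg : ∀ x : G, -x = x⁻¹ := fun x => rfl
  have haddc : ∀ x, ∀ z ∈ commutator G, x + z = x * z := by
    intro x z hz
    rw [hadd, (hz0 x z (fun w => (Subgroup.mem_center_iff.1 (hc hz) w).symm)).2, one_pow, mul_one]
  have hnsmul : ∀ (k : ℕ) (x : G), k • x = x ^ k := by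
    intro k x
    induction k with
    | zero => simp [hzero]
    | succ k ih =>
      rw [succ_nsmul, ih, hadd, commutatorElement_eq_one_iff_mul_comm.2 (pow_mul_comm' x k).symm,
        one_pow, mul_one, pow_succ]
  let _ : Module (ZMod p) G := AddCommGroup.zmodModule (by intro x; rw [hnsmul, hexp, hzero])
  exact exists_form_aux p m n q hadd hzero hneg hq hp hcard hexp hc hcc

end
end BaerAux

/-- For an odd prime `p` and `m, n ≥ 1`, the isomorphism classes of class-2 groups of order
`p ^ (m + n)` and exponent `p` with commutator subgroup of order `p ^ n` are in bijection
with the congruence orbits of `n`-dimensional subspaces of antisymmetric `m × m` matrices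
over `ZMod p`. -/
theorem classTwoGroups_equiv_grassmannian_orbits
    (p m n : ℕ) (hp : p.Prime) (hodd : Odd p) (hm : 1 ≤ m) (hn : 1 ≤ n) :
    Nonempty (Quot (isoRel p m n) ≃ Quot (congRel p m n)) := by
  have hsymm : ∀ {s t}, isoRel p m n s t → isoRel p m n t s := fun ⟨e⟩ => ⟨e.symm⟩
  have heqv : Equivalence (isoRel p m n) :=
    ⟨fun s => ⟨MulEquiv.refl _⟩, hsymm, fun ⟨e⟩ ⟨f⟩ => ⟨e.trans f⟩⟩
  let F : Quot (congRel p m n) → Quot (isoRel p m n) :=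
    Quot.map (BaerAux.toGroup hp hodd) (BaerAux.iso_of_cong hp hodd)
  refine ⟨(Equiv.ofBijective F ⟨?_, ?_⟩).symm⟩
  · rintro ⟨V⟩ ⟨W⟩ h
    have h1 : isoRel p m n (BaerAux.toGroup hp hodd V) (BaerAux.toGroup hp hodd W) :=
      (Equivalence.quot_mk_eq_iff heqv _ _).1 h
    exact Quot.sound (BaerAux.cong_of_iso hp hodd W V (hsymm h1))
  · rintro ⟨s⟩
    obtain ⟨V, ⟨e⟩⟩ := BaerAux.exists_form p m n hp hodd s.card_eq s.exp_p s.comm_le_center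
      s.card_comm
    exact ⟨Quot.mk _ V, Quot.sound ⟨e.symm⟩⟩
end

section
/- Consider the following six 3-dimensional ZMod 3-subspaces of AS_4(ZMod 3), each given as the set of matrices obtained by letting a, b, c range over ZMod 3: V₁ = {!![0,c,a,0; −c,0,b,0; −a,−b,0,0; 0,0,0,0]}, V₂ = {!![0,0,a,0; 0,0,b,0; −a,−b,0,c; 0,0,−c,0]}, V₃ = {!![0,c,a,0; −c,0,b,0; −a,−b,0,c; 0,0,−c,0]}, V₄ = {!![0,0,a,c; 0,0,b,0; −a,−b,0,0; −c,0,0,0]}, V₅ = {!![0,c,a,0; −c,0,0,b; −a,0,0,c; 0,−b,−c,0]}, V₆ = {!![0,c,a,b; −c,0,0,a; −a,0,0,−c; −b,−a,c,0]}. Then every 3-dimensional ZMod 3-subspace of AS_4(ZMod 3) is congruent to exactly one of V₁, …, V₆; in particular V₁, …, V₆ are pairwise non-congruent. -/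
open Matrix

/-- The six representative 3-dimensional subspaces of antisymmetric `4 × 4` matrices over
`ZMod 3`, given as sets of matrices with `a, b, c` ranging over `ZMod 3`. -/
def reps3of4 : Fin 6 → Set (Matrix (Fin 4) (Fin 4) (ZMod 3)) :=
  ![{M | ∃ a b c : ZMod 3, M = !![0,c,a,0; -c,0,b,0; -a,-b,0,0; 0,0,0,0]},
    {M | ∃ a b c : ZMod 3, M = !![0,0,a,0; 0,0,b,0; -a,-b,0,c; 0,0,-c,0]},
    {M | ∃ a b c : ZMod 3, M = !![0,c,a,0; -c,0,b,0; -a,-b,0,c; 0,0,-c,0]},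
    {M | ∃ a b c : ZMod 3, M = !![0,0,a,c; 0,0,b,0; -a,-b,0,0; -c,0,0,0]},
    {M | ∃ a b c : ZMod 3, M = !![0,c,a,0; -c,0,0,b; -a,0,0,c; 0,-b,-c,0]},
    {M | ∃ a b c : ZMod 3, M = !![0,c,a,b; -c,0,0,a; -a,0,0,-c; -b,-a,c,0]}]

namespace AS4

/-- Abbreviation for the ambient matrix space. -/
abbrev Mat := Matrix (Fin 4) (Fin 4) (ZMod 3)

/-- The alternating matrix with given upper-triangular entries. -/
def A (a b c d e f : ZMod 3) : Mat :=
  !![0,a,b,c; -a,0,d,e; -b,-d,0,f; -c,-e,-f,0]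

/-- Congruence by `Q`, as a linear map. -/
def phi (Q : Mat) : Mat →ₗ[ZMod 3] Mat where
  toFun X := Q * X * Qᵀ
  map_add' X Y := by rw [mul_add, add_mul]
  map_smul' c X := by simp

theorem phi_apply (Q X : Mat) : phi Q X = Q * X * Qᵀ := rfl

theorem phi_mul (Q R X : Mat) : phi (Q * R) X = phi Q (phi R X) := by
  simp only [phi_apply, Matrix.transpose_mul, Matrix.mul_assoc]

theorem phi_one (X : Mat) : phi 1 X = X := by simp [phi_apply]

theorem phi_inv_left (Q : Mat) (h : Q.det ≠ 0) (X : Mat) : phi Q⁻¹ (phi Q X) = X := by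
  rw [← phi_mul, Matrix.nonsing_inv_mul _ (isUnit_iff_ne_zero.mpr h), phi_one]

theorem phi_inv_right (Q : Mat) (h : Q.det ≠ 0) (X : Mat) : phi Q (phi Q⁻¹ X) = X := by
  rw [← phi_mul, Matrix.mul_nonsing_inv _ (isUnit_iff_ne_zero.mpr h), phi_one]

/-- Congruence by an invertible `Q`, as a linear equivalence. -/
noncomputable def phiE (Q : Mat) (h : Q.det ≠ 0) : Mat ≃ₗ[ZMod 3] Mat :=
  { phi Q with
    invFun := phi Q⁻¹
    left_inv := phi_inv_left Q h
    right_inv := phi_inv_right Q h }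

/-- Alternating subspaces of dimension three. -/
def H (V : Submodule (ZMod 3) Mat) : Prop :=
  (∀ X ∈ V, Xᵀ = -X) ∧ Module.finrank (ZMod 3) V = 3

/-- Some representative can be carried into `V`. -/
def G (V : Submodule (ZMod 3) Mat) : Prop :=
  ∃ i, ∃ Q : Mat, Q.det ≠ 0 ∧ ∀ M ∈ reps3of4 i, phi Q M ∈ V

theorem G_of_comap {V : Submodule (ZMod 3) Mat} (Q : Mat) (h : Q.det ≠ 0)
    (hG : G (V.comap (phi Q))) : G V := by
  obtain ⟨i, R, hR, hM⟩ := hG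
  refine ⟨i, Q * R, by rw [Matrix.det_mul]; exact mul_ne_zero h hR, fun M hm => ?_⟩
  rw [phi_mul]
  exact hM M hm

theorem H_comap {V : Submodule (ZMod 3) Mat} (Q : Mat) (h : Q.det ≠ 0)
    (hV : H V) : H (V.comap (phi Q)) := by
  constructor
  · intro X hX
    have h1 := hV.1 _ hX
    have h2 : phi Q Xᵀ = phi Q (-X) := by
      rw [map_neg, ← h1]
      simp [phi_apply, Matrix.mul_assoc]
    rw [← phi_inv_left Q h Xᵀ, h2, phi_inv_left Q h]
  · have : V.comap (phi Q) = V.map ((phiE Q h).symm : Mat →ₗ[ZMod 3] Mat) := by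
      rw [← Submodule.comap_equiv_eq_map_symm]
      rfl
    rw [this, LinearEquiv.finrank_map_eq]
    exact hV.2

theorem eq_A {X : Mat} (h : Xᵀ = -X) :
    X = A (X 0 1) (X 0 2) (X 0 3) (X 1 2) (X 1 3) (X 2 3) := by
  have h' : ∀ i j, X j i = - X i j := fun i j => congrFun (congrFun h i) j
  have hd : ∀ x : ZMod 3, x = -x → x = 0 := by decide
  ext i j
  fin_cases i <;> fin_cases j <;> simp [A] <;> first | exact hd _ (h' _ _) | exact h' _ _

theorem exists_A {V : Submodule (ZMod 3) Mat} (hV : H V) {X : Mat} (hX : X ∈ V) :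
    ∃ a b c d e f, X = A a b c d e f := ⟨_, _, _, _, _, _, eq_A (hV.1 X hX)⟩

theorem A_add (a b c d e f a' b' c' d' e' f' : ZMod 3) :
    A a b c d e f + A a' b' c' d' e' f' =
      A (a + a') (b + b') (c + c') (d + d') (e + e') (f + f') := by
  ext i j
  fin_cases i <;> fin_cases j <;> simp [A] <;> ring

theorem smul_A (t a b c d e f : ZMod 3) :
    t • A a b c d e f = A (t * a) (t * b) (t * c) (t * d) (t * e) (t * f) := by
  ext i j
  fin_cases i <;> fin_cases j <;> simp [A]

theorem A_zero : A 0 0 0 0 0 0 = 0 := by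
  ext i j
  fin_cases i <;> fin_cases j <;> simp [A]

theorem exists_not_mem {V : Submodule (ZMod 3) Mat} (hV : H V) (X Y : Mat) :
    ∃ Z ∈ V, ∀ s t : ZMod 3, Z ≠ s • X + t • Y := by
  by_contra! hcon
  have hle : V ≤ Submodule.span (ZMod 3) (({X, Y} : Finset Mat) : Set Mat) := by
    intro Z hZ
    obtain ⟨s, t, rfl⟩ := hcon Z hZ
    refine add_mem (Submodule.smul_mem _ _ (Submodule.subset_span ?_))
      (Submodule.smul_mem _ _ (Submodule.subset_span ?_)) <;> simp
  have h1 := Submodule.finrank_mono hle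
  have h2 := finrank_span_finset_le_card (R := ZMod 3) ({X, Y} : Finset Mat)
  have h3 := Finset.card_le_two (a := X) (b := Y)
  rw [hV.2] at h1
  unfold Set.finrank at h2
  omega

set_option maxHeartbeats 2000000 in
/-- The form of `phi Q` on an alternating matrix, entry by entry. -/
theorem phi_A (Q : Mat) (a b c d e f : ZMod 3) :
    phi Q (A a b c d e f) =
      let w := fun i j =>
        a * (Q i 0 * Q j 1 - Q i 1 * Q j 0) + b * (Q i 0 * Q j 2 - Q i 2 * Q j 0) +
        c * (Q i 0 * Q j 3 - Q i 3 * Q j 0) + d * (Q i 1 * Q j 2 - Q i 2 * Q j 1) +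
        e * (Q i 1 * Q j 3 - Q i 3 * Q j 1) + f * (Q i 2 * Q j 3 - Q i 3 * Q j 2)
      A (w 0 1) (w 0 2) (w 0 3) (w 1 2) (w 1 3) (w 2 3) := by
  ext i j
  fin_cases i <;> fin_cases j <;>
    simp [A, phi_apply, Matrix.mul_apply, Fin.sum_univ_four] <;> ring

theorem rep_A (i : Fin 6) {M : Mat} (h : M ∈ reps3of4 i) :
    ∃ a b c : ZMod 3, M = (![A c a 0 b 0 0, A 0 a 0 b 0 c, A c a 0 b 0 c, A 0 a c b 0 0,
      A c a 0 0 b c, A c a b 0 a (-c)] : Fin 6 → Mat) i := by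
  fin_cases i <;> obtain ⟨a, b, c, rfl⟩ := h <;> refine ⟨a, b, c, ?_⟩ <;>
    simp [A]

theorem A_mem_comb {V : Submodule (ZMod 3) Mat} {X Y Z W : Mat} (hX : X ∈ V) (hY : Y ∈ V)
    (hZ : Z ∈ V) (r s t : ZMod 3) (h : W = r • X + s • Y + t • Z) : W ∈ V := by
  rw [h]
  exact add_mem (add_mem (V.smul_mem _ hX) (V.smul_mem _ hY)) (V.smul_mem _ hZ)

theorem A_congr {a b c d e f a' b' c' d' e' f' : ZMod 3} (h1 : a = a') (h2 : b = b')
    (h3 : c = c') (h4 : d = d') (h5 : e = e') (h6 : f = f') :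
    A a b c d e f = A a' b' c' d' e' f' := by
  subst h1 h2 h3 h4 h5 h6; rfl

theorem det_four (M : Mat) : M.det =
    (M 0 0 * M 1 1 - M 0 1 * M 1 0) * (M 2 2 * M 3 3 - M 2 3 * M 3 2)
    - (M 0 0 * M 1 2 - M 0 2 * M 1 0) * (M 2 1 * M 3 3 - M 2 3 * M 3 1)
    + (M 0 0 * M 1 3 - M 0 3 * M 1 0) * (M 2 1 * M 3 2 - M 2 2 * M 3 1)
    + (M 0 1 * M 1 2 - M 0 2 * M 1 1) * (M 2 0 * M 3 3 - M 2 3 * M 3 0)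
    - (M 0 1 * M 1 3 - M 0 3 * M 1 1) * (M 2 0 * M 3 2 - M 2 2 * M 3 0)
    + (M 0 2 * M 1 3 - M 0 3 * M 1 2) * (M 2 0 * M 3 1 - M 2 1 * M 3 0) := by
  rw [Matrix.det_succ_row_zero]
  simp [Fin.sum_univ_four, Matrix.det_fin_three, Fin.succAbove, Matrix.submatrix]
  ring

theorem inv3 : ∀ x : ZMod 3, x ≠ 0 → x * x = 1 := by decide

section leaves
variable {V : Submodule (ZMod 3) Mat}

theorem leaf_a (h1 : A 1 0 0 0 0 0 ∈ V) (h2 : A 0 0 0 0 0 1 ∈ V) (h3 : A 0 1 0 0 0 0 ∈ V) :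
    G V := by
  refine ⟨3, !![0,0,1,0; 0,1,0,0; 1,0,0,0; 0,0,0,1], by rw [det_four]; decide, fun M hM => ?_⟩
  obtain ⟨a, b, c, rfl⟩ := rep_A _ hM
  refine A_mem_comb h1 h2 h3 (-b) c (-a) ?_
  simp only [smul_A, A_add, phi_A, Matrix.cons_val]
  apply A_congr <;> simp

theorem leaf_b (h1 : A 1 0 0 0 0 0 ∈ V) (h2 : A 0 0 0 0 0 1 ∈ V) (h3 : A 0 1 0 0 1 0 ∈ V) :
    G V := by
  refine ⟨4, !![1,0,0,0; 0,0,1,0; 0,1,0,0; 0,0,0,1], by rw [det_four]; decide, fun M hM => ?_⟩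
  obtain ⟨a, b, c, rfl⟩ := rep_A _ hM
  refine A_mem_comb h1 h2 h3 a b c ?_
  simp only [smul_A, A_add, phi_A, Matrix.cons_val]
  apply A_congr <;> simp

theorem leaf_c (b c d : ZMod 3) (hne : ¬ (b = 0 ∧ c = 0 ∧ d = 0))
    (h1 : A 1 0 0 0 0 0 ∈ V) (h2 : A 0 1 0 0 0 0 ∈ V)
    (h3 : A 0 0 b c d 0 ∈ V) : G V := by
  by_cases hd : d = 0
  · subst hd
    by_cases hb : b = 0
    · subst hb
      have hc : c ≠ 0 := by tauto
      refine ⟨0, 1, by simp, fun M hM => ?_⟩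
      obtain ⟨x, y, z, rfl⟩ := rep_A _ hM
      refine A_mem_comb h1 h2 h3 z x (y * c) ?_
      have := inv3 c hc
      simp only [smul_A, A_add, phi_one, Matrix.cons_val]
      apply A_congr <;> grind
    · have hb2 := inv3 b hb
      by_cases hc : c = 0
      · subst hc
        refine ⟨1, !![0,0,1,0; 1,0,0,0; 0,1,0,0; 0,0,0,1], by rw [det_four]; decide,
          fun M hM => ?_⟩
        obtain ⟨x, y, z, rfl⟩ := rep_A _ hM
        refine A_mem_comb h1 h2 h3 (-x) (-y) (z * b) ?_
        simp only [smul_A, A_add, phi_A, Matrix.cons_val]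
        apply A_congr <;> simp <;> grind
      · have hc2 := inv3 c hc
        refine ⟨2, !![0,0,1,0; 1,0,0,0; 0,1,0,0; 0,0,0,b*c], ?_, fun M hM => ?_⟩
        · rw [det_four]; simp [hb, hc]
        obtain ⟨x, y, z, rfl⟩ := rep_A _ hM
        refine A_mem_comb h1 h2 h3 (-x) (-y) (z * c) ?_
        simp only [smul_A, A_add, phi_A, Matrix.cons_val]
        apply A_congr <;> simp <;> grind
  · have hd2 := inv3 d hd
    -- path 3-1-2-4, composed with the shear that diagonalises the block
    refine ⟨3, !![b,0,1,0; d,0,0,0; 0,1,0,c*d; 0,0,0,1], ?_, fun M hM => ?_⟩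
    · rw [det_four]; simp [hd]
    obtain ⟨x, y, z, rfl⟩ := rep_A _ hM
    refine A_mem_comb h1 h2 h3 (-x * d) (-y + z * b * c * d) z ?_
    simp only [smul_A, A_add, phi_A, Matrix.cons_val]
    apply A_congr <;> simp <;> grind

theorem leaf_d (q r s : ZMod 3) (hn : ∀ t : ZMod 3, t * (t + s) - q * r ≠ 0)
    (h1 : A 1 0 0 0 0 0 ∈ V) (h2 : A 0 1 0 0 1 0 ∈ V)
    (h3 : A 0 0 q r s 0 ∈ V) : G V := by
  have hr : r ≠ 0 := by
    rintro rfl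
    exact hn 0 (by simp)
  have key : ∀ q r s : ZMod 3, (∀ t : ZMod 3, t * (t + s) - q * r ≠ 0) →
    s * s + q * r = -1 := by decide
  have hk := key q r s hn
  refine ⟨5, !![1,0,0,-s; 0,0,0,-r; 0,-r,0,0; 0,s,1,0], ?_, fun M hM => ?_⟩
  · rw [det_four]; simp [hr]
  obtain ⟨a, b, c, rfl⟩ := rep_A _ hM
  refine A_mem_comb h1 h2 h3 (-r * b) (-r * c - r * a * s) (-r * a) ?_
  simp only [smul_A, A_add, phi_A, Matrix.cons_val]
  apply A_congr <;> simp <;> grind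

end leaves

section stages
variable {V : Submodule (ZMod 3) Mat}

theorem A_ne_zero {a b c d e f : ZMod 3} (h : A a b c d e f ≠ 0) :
    a ≠ 0 ∨ b ≠ 0 ∨ c ≠ 0 ∨ d ≠ 0 ∨ e ≠ 0 ∨ f ≠ 0 := by
  by_contra! hc
  obtain ⟨rfl, rfl, rfl, rfl, rfl, rfl⟩ := hc
  exact h A_zero

/-- A nonzero isotropic alternating matrix is congruent to `E₁₂`. -/
theorem exists_Q_E12 (a b c d e f : ZMod 3) (h0 : A a b c d e f ≠ 0)
    (hp : a * f - b * e + c * d = 0) :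
    ∃ Q : Mat, Q.det ≠ 0 ∧ phi Q (A 1 0 0 0 0 0) = A a b c d e f := by
  rcases A_ne_zero h0 with h | h | h | h | h | h <;> have h2 := inv3 _ h
  · refine ⟨!![1,0,0,0; 0,a,0,0; -a*d,b,1,0; -a*e,c,0,1], ?_, ?_⟩
    · rw [det_four]; simp [h]
    · rw [phi_A]; apply A_congr <;> simp <;> grind
  · refine ⟨!![1,0,0,0; b*d,a,1,0; 0,b,0,0; -b*f,c,0,1], ?_, ?_⟩
    · rw [det_four]; simp [h]
    · rw [phi_A]; apply A_congr <;> simp <;> grind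
  · refine ⟨!![1,0,0,0; c*e,a,1,0; c*f,b,0,1; 0,c,0,0], ?_, ?_⟩
    · rw [det_four]; simp [h]
    · rw [phi_A]; apply A_congr <;> simp <;> grind
  · refine ⟨!![d*b,-a,1,0; 1,0,0,0; 0,d,0,0; -d*f,e,0,1], ?_, ?_⟩
    · rw [det_four]; simp [h]
    · rw [phi_A]; apply A_congr <;> simp <;> grind
  · refine ⟨!![e*c,-a,1,0; 1,0,0,0; e*f,d,0,1; 0,e,0,0], ?_, ?_⟩
    · rw [det_four]; simp [h]
    · rw [phi_A]; apply A_congr <;> simp <;> grind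
  · refine ⟨!![f*c,-b,1,0; f*e,-d,0,1; 1,0,0,0; 0,f,0,0], ?_, ?_⟩
    · rw [det_four]; simp [h]
    · rw [phi_A]; apply A_congr <;> simp <;> grind

theorem block_rank_two (p q r s : ZMod 3) (h : p * s - q * r ≠ 0) :
    ∃ Q : Mat, Q.det ≠ 0 ∧ phi Q (A 0 1 0 0 1 0) = A 0 p q r s 0 ∧
      (∃ k : ZMod 3, phi Q (A 1 0 0 0 0 0) = k • A 1 0 0 0 0 0) ∧
      (∃ k : ZMod 3, phi Q (A 0 0 0 0 0 1) = k • A 0 0 0 0 0 1) := by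
  refine ⟨!![p,q,0,0; r,s,0,0; 0,0,1,0; 0,0,0,1], ?_, ?_, ⟨p * s - q * r, ?_⟩, ⟨1, ?_⟩⟩
  · rw [det_four]; simpa using h
  all_goals
    simp only [phi_A, smul_A]
    apply A_congr <;> simp

theorem block_rank_one (p q r s : ZMod 3) (h : p * s - q * r = 0)
    (h0 : ¬ (p = 0 ∧ q = 0 ∧ r = 0 ∧ s = 0)) :
    ∃ Q : Mat, Q.det ≠ 0 ∧ phi Q (A 0 1 0 0 0 0) = A 0 p q r s 0 ∧
      (∃ k : ZMod 3, phi Q (A 1 0 0 0 0 0) = k • A 1 0 0 0 0 0) ∧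
      (∃ k : ZMod 3, phi Q (A 0 0 0 0 0 1) = k • A 0 0 0 0 0 1) := by
  have key : ∀ p q r s : ZMod 3, p * s - q * r = 0 → ∃ x y z w : ZMod 3,
    p = x * z ∧ q = x * w ∧ r = y * z ∧ s = y * w := by decide +kernel
  have aniso : ∀ x y : ZMod 3, x * x + y * y = 0 → x = 0 ∧ y = 0 := by decide
  obtain ⟨x, y, z, w, rfl, rfl, rfl, rfl⟩ := key p q r s h
  refine ⟨!![x,-y,0,0; y,x,0,0; 0,0,z,-w; 0,0,w,z], ?_, ?_, ⟨x * x + y * y, ?_⟩,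
    ⟨z * z + w * w, ?_⟩⟩
  · rw [det_four]
    intro hd
    have hd' : (x * x + y * y) * (z * z + w * w) = 0 := by
      rw [← hd]; simp
    rcases mul_eq_zero.mp hd' with h1 | h1 <;> obtain ⟨rfl, rfl⟩ := aniso _ _ h1 <;>
      simp at h0
  all_goals
    simp only [phi_A, smul_A]
    apply A_congr <;> simp
  all_goals ring

/-- Subtracting multiples of elements of `V`. -/
theorem mem_sub {X Y Z W : Mat} (hX : X ∈ V) (hY : Y ∈ V) (hZ : Z ∈ V) (s t : ZMod 3)
    (h : W = Z + s • X + t • Y) : W ∈ V := by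
  rw [h]
  exact add_mem (add_mem hZ (V.smul_mem _ hX)) (V.smul_mem _ hY)

theorem stageA (hV : H V) (h1 : A 1 0 0 0 0 0 ∈ V) (h2 : A 0 0 0 0 0 1 ∈ V) : G V := by
  obtain ⟨Z, hZ, hn⟩ := exists_not_mem hV (A 1 0 0 0 0 0) (A 0 0 0 0 0 1)
  obtain ⟨a, p, q, r, s, f, rfl⟩ := exists_A hV hZ
  have hB : A 0 p q r s 0 ∈ V := by
    refine mem_sub h1 h2 hZ (-a) (-f) ?_
    simp only [smul_A, A_add]
    apply A_congr <;> simp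
  have hB0 : ¬ (p = 0 ∧ q = 0 ∧ r = 0 ∧ s = 0) := by
    rintro ⟨rfl, rfl, rfl, rfl⟩
    apply hn a f
    simp only [smul_A, A_add]
    apply A_congr <;> simp
  by_cases hd : p * s - q * r = 0
  · obtain ⟨Q, hQ, e1, ⟨k, e2⟩, ⟨l, e3⟩⟩ := block_rank_one p q r s hd hB0
    apply G_of_comap Q hQ
    apply leaf_a
    · rw [Submodule.mem_comap, e2]; exact V.smul_mem _ h1
    · rw [Submodule.mem_comap, e3]; exact V.smul_mem _ h2
    · rw [Submodule.mem_comap, e1]; exact hB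
  · obtain ⟨Q, hQ, e1, ⟨k, e2⟩, ⟨l, e3⟩⟩ := block_rank_two p q r s hd
    apply G_of_comap Q hQ
    apply leaf_b
    · rw [Submodule.mem_comap, e2]; exact V.smul_mem _ h1
    · rw [Submodule.mem_comap, e3]; exact V.smul_mem _ h2
    · rw [Submodule.mem_comap, e1]; exact hB

theorem stageF (hV : H V) (h1 : A 1 0 0 0 0 0 ∈ V) {a b c d e f : ZMod 3}
    (hY : A a b c d e f ∈ V) (hf : f ≠ 0) : G V := by
  have hf2 := inv3 f hf
  have hQ : Matrix.det (!![1,0,f*c,-f*b; 0,1,f*e,-f*d; 0,0,1,0; 0,0,0,1] : Mat) ≠ 0 := by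
    rw [det_four]; simp
  apply G_of_comap _ hQ
  apply stageA (H_comap _ hQ hV)
  · rw [Submodule.mem_comap]
    convert h1
    rw [phi_A]
    apply A_congr <;> simp
  · rw [Submodule.mem_comap]
    refine A_mem_comb h1 hY h1 (-f * a + b * e - c * d) f 0 ?_
    simp only [smul_A, A_add, phi_A]
    apply A_congr <;> simp <;> grind

theorem stageR (hV : H V) (h1 : A 1 0 0 0 0 0 ∈ V) {p q r s : ZMod 3}
    (hY : A 0 p q r s 0 ∈ V) (hd : p * s - q * r = 0)
    (h0 : ¬ (p = 0 ∧ q = 0 ∧ r = 0 ∧ s = 0)) : G V := by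
  obtain ⟨Q, hQ, e1, ⟨k, e2⟩, -⟩ := block_rank_one p q r s hd h0
  apply G_of_comap Q hQ
  have hW := H_comap Q hQ hV
  have g1 : A 1 0 0 0 0 0 ∈ V.comap (phi Q) := by
    rw [Submodule.mem_comap, e2]; exact V.smul_mem _ h1
  have g2 : A 0 1 0 0 0 0 ∈ V.comap (phi Q) := by
    rw [Submodule.mem_comap, e1]; exact hY
  obtain ⟨Z, hZ, hn⟩ := exists_not_mem hW (A 1 0 0 0 0 0) (A 0 1 0 0 0 0)
  obtain ⟨a, b, c, d, e, f, rfl⟩ := exists_A hW hZ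
  by_cases hf : f = 0
  · subst hf
    apply leaf_c c d e _ g1 g2
    · refine mem_sub g1 g2 hZ (-a) (-b) ?_
      simp only [smul_A, A_add]
      apply A_congr <;> simp
    · rintro ⟨rfl, rfl, rfl⟩
      apply hn a b
      simp only [smul_A, A_add]
      apply A_congr <;> simp
  · exact stageF hW g1 hZ hf

theorem stageC (hV : H V) (h1 : A 1 0 0 0 0 0 ∈ V) (h2 : A 0 1 0 0 1 0 ∈ V) : G V := by
  obtain ⟨Z, hZ, hn⟩ := exists_not_mem hV (A 1 0 0 0 0 0) (A 0 1 0 0 1 0)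
  obtain ⟨a, b, q, r, s, f, rfl⟩ := exists_A hV hZ
  by_cases hf : f = 0
  swap
  · exact stageF hV h1 hZ hf
  subst hf
  have hB : ∀ t, A 0 t q r (t + (s - b)) 0 ∈ V := by
    intro t
    refine mem_sub h1 h2 hZ (-a) (t - b) ?_
    simp only [smul_A, A_add]
    apply A_congr <;> simp
    ring
  by_cases hex : ∃ t : ZMod 3, t * (t + (s - b)) - q * r = 0
  · obtain ⟨t, ht⟩ := hex
    apply stageR hV h1 (hB t) ht
    rintro ⟨rfl, rfl, rfl, h4⟩
    apply hn a b
    simp only [smul_A, A_add]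
    apply A_congr <;> simp
    linear_combination h4
  · push Not at hex
    exact leaf_d q r (s - b) hex h1 h2 (by simpa using hB 0)

theorem stageE (hV : H V) (h1 : A 1 0 0 0 0 0 ∈ V) : G V := by
  obtain ⟨Z, hZ, hn⟩ := exists_not_mem hV (A 1 0 0 0 0 0) 0
  obtain ⟨a, p, q, r, s, f, rfl⟩ := exists_A hV hZ
  by_cases hf : f = 0
  swap
  · exact stageF hV h1 hZ hf
  subst hf
  have hB : A 0 p q r s 0 ∈ V := by
    refine mem_sub h1 h1 hZ (-a) 0 ?_
    simp only [smul_A, A_add]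
    apply A_congr <;> simp
  by_cases hd : p * s - q * r = 0
  · apply stageR hV h1 hB hd
    rintro ⟨rfl, rfl, rfl, rfl⟩
    apply hn a 0
    rw [smul_zero, add_zero, smul_A]
    apply A_congr <;> simp
  · obtain ⟨Q, hQ, e1, ⟨k, e2⟩, -⟩ := block_rank_two p q r s hd
    apply G_of_comap Q hQ
    apply stageC (H_comap Q hQ hV)
    · rw [Submodule.mem_comap, e2]; exact V.smul_mem _ h1
    · rw [Submodule.mem_comap, e1]; exact hB

/-- Ternary quadratic forms over `ZMod 3` are isotropic. -/
theorem ternary : ∀ a b c d e f : ZMod 3, ∃ x y z : ZMod 3, (x ≠ 0 ∨ y ≠ 0 ∨ z ≠ 0) ∧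
    a * (x * x) + b * (y * y) + c * (z * z) + d * (x * y) + e * (x * z) + f * (y * z) = 0 := by
  decide +kernel

theorem exists_isotropic (hV : H V) : ∃ a b c d e f, A a b c d e f ∈ V ∧
    A a b c d e f ≠ 0 ∧ a * f - b * e + c * d = 0 := by
  obtain ⟨X, hX, nX⟩ := exists_not_mem hV 0 0
  obtain ⟨Y, hY, nY⟩ := exists_not_mem hV X 0
  obtain ⟨Z, hZ, nZ⟩ := exists_not_mem hV X Y
  obtain ⟨a, b, c, d, e, f, hXA⟩ := exists_A hV hX
  obtain ⟨a', b', c', d', e', f', hYA⟩ := exists_A hV hY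
  obtain ⟨a'', b'', c'', d'', e'', f'', hZA⟩ := exists_A hV hZ
  obtain ⟨x, y, z, hne, h⟩ := ternary (a * f - b * e + c * d) (a' * f' - b' * e' + c' * d')
    (a'' * f'' - b'' * e'' + c'' * d'')
    (a * f' + a' * f - b * e' - b' * e + c * d' + c' * d)
    (a * f'' + a'' * f - b * e'' - b'' * e + c * d'' + c'' * d)
    (a' * f'' + a'' * f' - b' * e'' - b'' * e' + c' * d'' + c'' * d')
  have hE : x • X + y • Y + z • Z = A (x * a + y * a' + z * a'') (x * b + y * b' + z * b'')
      (x * c + y * c' + z * c'') (x * d + y * d' + z * d'') (x * e + y * e' + z * e'')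
      (x * f + y * f' + z * f'') := by
    rw [hXA, hYA, hZA]
    simp only [smul_A, A_add]
  refine ⟨_, _, _, _, _, _, hE ▸ A_mem_comb hX hY hZ x y z rfl, ?_, ?_⟩
  · rw [← hE]
    intro h0
    by_cases hz : z = 0
    · subst hz
      by_cases hy : y = 0
      · subst hy
        have hx : x ≠ 0 := by tauto
        apply nX 0 0
        simpa [hx] using h0
      · apply nY (-(y * x)) 0
        have h2 := inv3 y hy
        calc Y = (y * y) • Y := by rw [h2, one_smul]
          _ = y • (x • X + y • Y + (0 : ZMod 3) • Z) + (-(y * x)) • X + (0 : ZMod 3) • 0 := by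
            module
          _ = _ := by rw [h0]; simp
    · apply nZ (-(z * x)) (-(z * y))
      have h2 := inv3 z hz
      calc Z = (z * z) • Z := by rw [h2, one_smul]
        _ = z • (x • X + y • Y + z • Z) + ((-(z * x)) • X + (-(z * y)) • Y) := by
          module
        _ = _ := by rw [h0]; simp
  · linear_combination h

theorem G_of_H (hV : H V) : G V := by
  obtain ⟨a, b, c, d, e, f, hm, h0, hp⟩ := exists_isotropic hV
  obtain ⟨Q, hQ, hE⟩ := exists_Q_E12 a b c d e f h0 hp
  apply G_of_comap Q hQ
  apply stageE (H_comap Q hQ hV)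
  rw [Submodule.mem_comap, hE]
  exact hm

end stages

/-- Parametrisation of the representatives. -/
def par (i : Fin 6) (t : ZMod 3 × ZMod 3 × ZMod 3) : Mat :=
  (![A t.2.2 t.1 0 t.2.1 0 0, A 0 t.1 0 t.2.1 0 t.2.2, A t.2.2 t.1 0 t.2.1 0 t.2.2,
    A 0 t.1 t.2.2 t.2.1 0 0, A t.2.2 t.1 0 0 t.2.1 t.2.2,
    A t.2.2 t.1 t.2.1 0 t.1 (-t.2.2)] : Fin 6 → Mat) i

theorem reps_eq (i : Fin 6) : reps3of4 i = Set.range (par i) := by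
  ext M
  constructor
  · intro h
    obtain ⟨a, b, c, rfl⟩ := rep_A i h
    exact ⟨(a, b, c), rfl⟩
  · rintro ⟨⟨a, b, c⟩, rfl⟩
    fin_cases i <;> refine ⟨a, b, c, ?_⟩ <;> simp [par, A]

theorem par_inj (i : Fin 6) : Function.Injective (par i) := by
  rintro ⟨a, b, c⟩ ⟨a', b', c'⟩ h
  have h' : ∀ k l, par i (a, b, c) k l = par i (a', b', c') k l := fun k l => by rw [h]
  have h1 := h' 0 1
  have h2 := h' 0 2
  have h3 := h' 0 3
  have h4 := h' 1 2
  have h5 := h' 1 3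
  have h6 := h' 2 3
  clear h h'
  fin_cases i <;> simp [par, A] at h1 h2 h3 h4 h5 h6 ⊢ <;> tauto

theorem card_reps (i : Fin 6) : (reps3of4 i).ncard = 27 := by
  rw [reps_eq, Set.ncard_range_of_injective (par_inj i)]
  simp [Nat.card_eq_fintype_card]

theorem phi_inj (Q : Mat) (h : Q.det ≠ 0) : Function.Injective (phi Q) :=
  (phiE Q h).injective

theorem exists_congr {V : Submodule (ZMod 3) Mat} (hV : H V) :
    ∃ i, ∃ P : Mat, P.det ≠ 0 ∧ reps3of4 i = phi P '' (V : Set Mat) := by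
  obtain ⟨i, Q, hQ, hM⟩ := G_of_H hV
  have hcard : (V : Set Mat).ncard = 27 := by
    have h1 : Nat.card V = Nat.card (ZMod 3) ^ Module.finrank (ZMod 3) V :=
      Module.natCard_eq_pow_finrank
    rw [hV.2] at h1
    rw [← Nat.card_coe_set_eq]
    simpa using h1
  have heq : phi Q '' reps3of4 i = (V : Set Mat) := by
    apply Set.eq_of_subset_of_ncard_le
    · rintro _ ⟨M, hm, rfl⟩
      exact hM M hm
    · rw [Set.ncard_image_of_injective _ (phi_inj Q hQ), card_reps, hcard]
    · exact Set.toFinite _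
  refine ⟨i, Q⁻¹, ?_, ?_⟩
  · rw [Matrix.det_nonsing_inv]
    simpa using hQ
  · rw [← heq, Set.image_image]
    simp [phi_inv_left Q hQ]

theorem det_A (a b c d e f : ZMod 3) : (A a b c d e f).det = 0 ↔ a * f - b * e + c * d = 0 := by
  have : (A a b c d e f).det = (a * f - b * e + c * d) ^ 2 := by
    rw [det_four]; simp [A]; ring
  rw [this]
  exact pow_eq_zero_iff two_ne_zero

/-- Pfaffian of a representative. -/
def pf (i : Fin 6) (t : ZMod 3 × ZMod 3 × ZMod 3) : ZMod 3 :=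
  (![0, 0, t.2.2 * t.2.2, t.2.2 * t.2.1, t.2.2 * t.2.2 - t.1 * t.2.1,
    -(t.2.2 * t.2.2) - t.1 * t.1] : Fin 6 → ZMod 3) i

theorem det_par (i : Fin 6) (t : ZMod 3 × ZMod 3 × ZMod 3) :
    (par i t).det = 0 ↔ pf i t = 0 := by
  fin_cases i <;> simp [par, det_A, pf]

theorem card_sing (i : Fin 6) :
    {M ∈ reps3of4 i | M.det = 0}.ncard = (![27, 27, 9, 15, 9, 3] : Fin 6 → ℕ) i := by
  have : {M ∈ reps3of4 i | M.det = 0} =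
      par i '' ((Finset.univ.filter fun t => pf i t = 0 : Finset _) : Set _) := by
    ext M
    rw [reps_eq]
    constructor
    · rintro ⟨⟨t, rfl⟩, ht⟩
      exact ⟨t, by simpa using (det_par i t).mp ht, rfl⟩
    · rintro ⟨t, ht, rfl⟩
      exact ⟨⟨t, rfl⟩, (det_par i t).mpr (by simpa using ht)⟩
  rw [this, Set.ncard_image_of_injective _ (par_inj i), Set.ncard_coe_finset]
  clear this
  revert i
  decide +kernel

theorem det_phi (P M : Mat) (h : P.det ≠ 0) : (phi P M).det = 0 ↔ M.det = 0 := by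
  simp [phi_apply, h]

theorem card_sing_eq {i j : Fin 6} {P : Mat} (h : P.det ≠ 0)
    (he : reps3of4 j = phi P '' reps3of4 i) :
    (![27, 27, 9, 15, 9, 3] : Fin 6 → ℕ) j = (![27, 27, 9, 15, 9, 3] : Fin 6 → ℕ) i := by
  rw [← card_sing i, ← card_sing j,
    ← Set.ncard_image_of_injective {M ∈ reps3of4 i | M.det = 0} (phi_inj P h)]
  congr 1
  ext M
  rw [he]
  constructor
  · rintro ⟨⟨N, hN, rfl⟩, hd⟩
    exact ⟨N, ⟨hN, (det_phi P N h).mp hd⟩, rfl⟩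
  · rintro ⟨N, ⟨hN, hd⟩, rfl⟩
    exact ⟨⟨N, hN, rfl⟩, (det_phi P N h).mpr hd⟩

theorem not_01 {P : Mat} (h : P.det ≠ 0) (he : reps3of4 0 = phi P '' reps3of4 1) : False := by
  -- some nonzero vector kills all of `V₁`
  have hx : ∀ M ∈ reps3of4 0, M *ᵥ ![0,0,0,1] = 0 := by
    rintro M ⟨a, b, c, rfl⟩
    ext k
    fin_cases k <;> simp [Matrix.mulVec, dotProduct, Fin.sum_univ_four]
  have hy : ∀ M ∈ reps3of4 1, M *ᵥ (Pᵀ *ᵥ ![0,0,0,1]) = 0 := by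
    intro M hM
    have h1 := hx (phi P M) (he ▸ Set.mem_image_of_mem _ hM)
    rw [phi_apply, ← Matrix.mulVec_mulVec, ← Matrix.mulVec_mulVec] at h1
    exact Matrix.eq_zero_of_mulVec_eq_zero h h1
  have hz : Pᵀ *ᵥ ![0,0,0,1] ≠ 0 := by
    intro h0
    have h1 := Matrix.eq_zero_of_mulVec_eq_zero (by rwa [Matrix.det_transpose]) h0
    have := congrFun h1 3
    simp at this
  apply hz
  generalize Pᵀ *ᵥ ![0,0,0,1] = y at hy
  have k1 := hy (par 1 (1, 0, 0)) (by rw [reps_eq]; exact ⟨_, rfl⟩)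
  have k2 := hy (par 1 (0, 1, 0)) (by rw [reps_eq]; exact ⟨_, rfl⟩)
  have k3 := hy (par 1 (0, 0, 1)) (by rw [reps_eq]; exact ⟨_, rfl⟩)
  have e0 := congrFun k1 2
  have e1 := congrFun k2 2
  have e2 := congrFun k1 0
  have e3 := congrFun k3 2
  simp [par, A, Matrix.mulVec, dotProduct, Fin.sum_univ_four] at e0 e1 e2 e3
  ext k
  fin_cases k <;> simp [e0, e1, e2, e3]

theorem not_42 {P : Mat} (h : P.det ≠ 0) (he : reps3of4 4 = phi P '' reps3of4 2) : False := by
  have hx : ∀ M ∈ reps3of4 2, ∀ N ∈ reps3of4 2, M.det = 0 → N.det = 0 → (M + N).det = 0 := by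
    rw [reps_eq]
    rintro _ ⟨⟨a, b, c⟩, rfl⟩ _ ⟨⟨a', b', c'⟩, rfl⟩ h1 h2
    rw [det_par] at h1 h2
    simp [pf] at h1 h2
    subst h1 h2
    simp [par, A_add, det_A]
  have m1 : par 4 (1, 0, 0) ∈ phi P '' reps3of4 2 := by rw [← he, reps_eq]; exact ⟨_, rfl⟩
  have m2 : par 4 (0, 1, 0) ∈ phi P '' reps3of4 2 := by rw [← he, reps_eq]; exact ⟨_, rfl⟩
  obtain ⟨M, hM, eM⟩ := m1
  obtain ⟨N, hN, eN⟩ := m2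
  have d1 : M.det = 0 := by
    rw [← det_phi P M h, eM, det_par]; decide
  have d2 : N.det = 0 := by
    rw [← det_phi P N h, eN, det_par]; decide
  have d3 := hx M hM N hN d1 d2
  rw [← det_phi P _ h, map_add, eM, eN] at d3
  simp [par, A_add, det_A] at d3

theorem reps_symm {i j : Fin 6} {P : Mat} (h : P.det ≠ 0)
    (he : reps3of4 j = phi P '' reps3of4 i) :
    P⁻¹.det ≠ 0 ∧ reps3of4 i = phi P⁻¹ '' reps3of4 j := by
  refine ⟨?_, ?_⟩
  · rw [Matrix.det_nonsing_inv]
    simpa using h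
  · rw [he, Set.image_image]
    simp [phi_inv_left P h]

theorem noncongr {i j : Fin 6} {P : Mat} (h : P.det ≠ 0)
    (he : reps3of4 j = phi P '' reps3of4 i) : i = j := by
  have hc := card_sing_eq h he
  obtain ⟨h', he'⟩ := reps_symm h he
  have key : ∀ i j : Fin 6,
      (![27, 27, 9, 15, 9, 3] : Fin 6 → ℕ) j = (![27, 27, 9, 15, 9, 3] : Fin 6 → ℕ) i →
      i = j ∨ (i = 0 ∧ j = 1) ∨ (i = 1 ∧ j = 0) ∨ (i = 2 ∧ j = 4) ∨ (i = 4 ∧ j = 2) := by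
    decide
  rcases key i j hc with h0 | ⟨rfl, rfl⟩ | ⟨rfl, rfl⟩ | ⟨rfl, rfl⟩ | ⟨rfl, rfl⟩
  · exact h0
  · exact (not_01 h' he').elim
  · exact (not_01 h he).elim
  · exact (not_42 h he).elim
  · exact (not_42 h' he').elim

theorem det_GL (P : GL (Fin 4) (ZMod 3)) : (P : Mat).det ≠ 0 :=
  ((Matrix.isUnit_iff_isUnit_det _).mp P.isUnit).ne_zero

end AS4

/-- Every 3-dimensional `ZMod 3`-subspace of the antisymmetric `4 × 4` matrices over `ZMod 3`
is congruent to exactly one of the six representatives `reps3of4`; in particular the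
representatives are pairwise non-congruent. -/
theorem three_dim_subspaces_of_AS4_classification :
    (∀ V : Submodule (ZMod 3) (Matrix (Fin 4) (Fin 4) (ZMod 3)),
      (∀ X ∈ V, Xᵀ = -X) → Module.finrank (ZMod 3) V = 3 →
      ∃! i : Fin 6, ∃ P : GL (Fin 4) (ZMod 3),
        reps3of4 i =
          (fun X => (P : Matrix (Fin 4) (Fin 4) (ZMod 3)) * X *
            (P : Matrix (Fin 4) (Fin 4) (ZMod 3))ᵀ) ''
            (V : Set (Matrix (Fin 4) (Fin 4) (ZMod 3)))) ∧
    (∀ i j : Fin 6, i ≠ j →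
      ¬ ∃ P : GL (Fin 4) (ZMod 3),
        reps3of4 j =
          (fun X => (P : Matrix (Fin 4) (Fin 4) (ZMod 3)) * X *
            (P : Matrix (Fin 4) (Fin 4) (ZMod 3))ᵀ) '' reps3of4 i) := by
  constructor
  · intro V hA hdim
    obtain ⟨i, P, hP, he⟩ := AS4.exists_congr (V := V) ⟨hA, hdim⟩
    refine ⟨i, ⟨Matrix.GeneralLinearGroup.mkOfDetNeZero P hP, he⟩, ?_⟩
    rintro j ⟨Q, hQ⟩
    have hQ' : reps3of4 j = AS4.phi (Q : AS4.Mat) '' (V : Set AS4.Mat) := hQ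
    have hV : (V : Set AS4.Mat) = AS4.phi P⁻¹ '' reps3of4 i := by
      rw [he, Set.image_image]
      simp [AS4.phi_inv_left P hP]
    refine (AS4.noncongr (P := (Q : AS4.Mat) * P⁻¹) ?_ ?_).symm
    · rw [Matrix.det_mul]
      refine mul_ne_zero (AS4.det_GL Q) ?_
      rw [Matrix.det_nonsing_inv]
      simpa using hP
    · rw [hQ', hV, Set.image_image]
      simp only [AS4.phi_mul]
  · rintro i j hij ⟨P, hP⟩
    exact hij (AS4.noncongr (AS4.det_GL P) hP)
end
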